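/- Let G=(V,E) be a supply graph and H=(V,D) a demand graph such that G+H is planar and connected. Then the maximum cardinality of a family of pairwise edge-disjoint D-cycles is at least 1/32 times the optimum value of the LP: maximize Σ_{e∈D} x_e subject to Σ_{e∈C∩D} x_e ≤ |C∩E| for every cut C of G+H and 0 ≤ x_e ≤ 1 for all e ∈ D. In particular, since any set D̄ ⊆ D admitting a complete solution yields a feasible 0-1 vector for this LP, this LP-rounding bound yields a 32-approximation for the edge-disjoint paths problem when G+H is planar. -/

import Mathlib

open scoped Classical

noncomputable section

/-- The edge set of a simple closed walk in the multigraph with endpoint map `ends`. -/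
def IsCycle {V ε : Type} (ends : ε → Sym2 V) (C : Finset ε) : Prop :=
  ∃ (n : ℕ) (v : Fin (n + 1) → V) (e : Fin (n + 1) → ε),
    Function.Injective v ∧ Function.Injective e ∧
    (∀ i, ends (e i) = s(v i, v (i + 1))) ∧
    C = Finset.image e Finset.univ

/-- The edge set of a simple (open) path. -/
def IsPath {V ε : Type} (ends : ε → Sym2 V) (P : Finset ε) : Prop :=
  ∃ (n : ℕ) (v : Fin (n + 1) → V) (e : Fin n → ε),
    Function.Injective v ∧ Function.Injective e ∧
    (∀ i : Fin n, ends (e i) = s(v i.castSucc, v i.succ)) ∧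
    P = Finset.image e Finset.univ

/-- The cut `δ(U)`: edges with exactly one endpoint in `U`. -/
def cutF {V ε : Type} [Fintype ε] (ends : ε → Sym2 V) (U : Set V) : Finset ε :=
  Finset.univ.filter (fun e => ∃ a b, ends e = s(a, b) ∧ a ∈ U ∧ b ∉ U)

/-- `U` is nonempty and induces a connected subgraph. -/
def ConnectedOn {V ε : Type} (ends : ε → Sym2 V) (U : Set V) : Prop :=
  U.Nonempty ∧ ∀ a ∈ U, ∀ b ∈ U,
    Relation.ReflTransGen (fun x y => x ∈ U ∧ y ∈ U ∧ ∃ e, ends e = s(x, y)) a b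

/-- The multigraph is connected. -/
def MGConnected {V ε : Type} (ends : ε → Sym2 V) : Prop :=
  ConnectedOn ends Set.univ

/-- `δ(U)` is a simple cut: both sides induce connected subgraphs. -/
def IsSimpleCut {V ε : Type} (ends : ε → Sym2 V) (U : Set V) : Prop :=
  ConnectedOn ends U ∧ ConnectedOn ends Uᶜ

/-- A `D`-cycle: a cycle containing exactly one demand edge. -/
def IsDCycle {V ε : Type} [DecidableEq ε] (ends : ε → Sym2 V) (Dem : Finset ε)
    (C : Finset ε) : Prop :=
  IsCycle ends C ∧ (C ∩ Dem).card = 1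

/-- A `D`-cut: a simple cut containing exactly one demand edge. -/
def IsDCut {V ε : Type} [Fintype ε] [DecidableEq ε] (ends : ε → Sym2 V) (Dem : Finset ε)
    (U : Set V) : Prop :=
  IsSimpleCut ends U ∧ (cutF ends U ∩ Dem).card = 1

/-- Planarity of a multigraph: there is a drawing in the plane with injective vertex
positions and arcs for the edges that are internally disjoint. -/
def IsPlanar {V ε : Type} (ends : ε → Sym2 V) : Prop :=
  ∃ (pos : V → ℝ × ℝ) (arc : ε → ℝ → ℝ × ℝ),
    Function.Injective pos ∧
    (∀ e, ContinuousOn (arc e) (Set.Icc 0 1)) ∧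
    (∀ e a b, ends e = s(a, b) →
      (arc e 0 = pos a ∧ arc e 1 = pos b) ∨ (arc e 0 = pos b ∧ arc e 1 = pos a)) ∧
    (∀ e, Set.InjOn (arc e) (Set.Ico 0 1)) ∧
    (∀ e f, e ≠ f → ∀ s ∈ Set.Ioo (0:ℝ) 1, ∀ t ∈ Set.Icc (0:ℝ) 1, arc e s ≠ arc f t) ∧
    (∀ e, ∀ s ∈ Set.Ioo (0:ℝ) 1, ∀ w, arc e s ≠ pos w)

/-- Every mod-2 vertex function sums to zero over the edge set `S`: all degrees are even. -/
def EvenSet {V ε : Type} (p q : ε → V) (S : Finset ε) : Prop :=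
  ∀ U : V → ZMod 2, ∑ e ∈ S, (U (p e) + U (q e)) = 0

/-- The mod-2 boundary of `S` is `a + b`. -/
def JoinSet {V ε : Type} (p q : ε → V) (S : Finset ε) (a b : V) : Prop :=
  ∀ U : V → ZMod 2, ∑ e ∈ S, (U (p e) + U (q e)) = U a + U b

/-- The mod-2 degree of `v` in the edge set `S`. -/
def degTwo {V ε : Type} (p q : ε → V) (S : Finset ε) (v : V) : ZMod 2 :=
  ∑ e ∈ S, ((if p e = v then 1 else 0) + (if q e = v then 1 else 0))

section Joins
variable {V ε : Type} {p q : ε → V}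

theorem ZMod.two_self_add (x : ZMod 2) : x + x = 0 := CharTwo.add_self_eq_zero x

theorem ZMod.two_eq_of_add_eq_zero {x y : ZMod 2} (h : x + y = 0) : x = y :=
  CharTwo.add_eq_zero.mp h

theorem JoinSet.even {S : Finset ε} {a : V} (h : JoinSet p q S a a) : EvenSet p q S :=
  fun U => by rw [h U, ZMod.two_self_add]

theorem JoinSet.symm {S : Finset ε} {a b : V} (h : JoinSet p q S a b) : JoinSet p q S b a :=
  fun U => by rw [h U, add_comm]

theorem JoinSet.singleton (e : ε) : JoinSet p q {e} (p e) (q e) := fun U => by simp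

theorem JoinSet.union {S T : Finset ε} {a b c : V} (h : JoinSet p q S a b)
    (h' : JoinSet p q T b c) (hd : Disjoint S T) : JoinSet p q (S ∪ T) a c := fun U => by
  rw [Finset.sum_union hd, h U, h' U]
  linear_combination ZMod.two_self_add (U b)

theorem JoinSet.sdiff {S T : Finset ε} {a b c : V} (h : JoinSet p q S a c)
    (h' : JoinSet p q T a b) (hT : T ⊆ S) : JoinSet p q (S \ T) b c := fun U => by
  have h1 := Finset.sum_sdiff (f := fun e => U (p e) + U (q e)) hT
  rw [h U, h' U] at h1
  linear_combination h1 - ZMod.two_self_add (U b)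

theorem JoinSet.degTwo_eq {S : Finset ε} {a b : V} (h : JoinSet p q S a b) (v : V) :
    degTwo p q S v = (if a = v then 1 else 0) + (if b = v then 1 else 0) :=
  h (fun x => if x = v then 1 else 0)

theorem exists_mem_of_degTwo_ne_zero {S : Finset ε} {v : V} (h : degTwo p q S v ≠ 0) :
    ∃ e ∈ S, ∃ u, u ≠ v ∧ JoinSet p q {e} v u := by
  obtain ⟨e, he, hne⟩ := Finset.exists_ne_zero_of_sum_ne_zero h
  refine ⟨e, he, ?_⟩
  by_cases h1 : p e = v <;> by_cases h2 : q e = v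
  · exact absurd (by simp [h1, h2, ZMod.two_self_add]) hne
  · exact ⟨q e, h2, h1 ▸ JoinSet.singleton e⟩
  · exact ⟨p e, h1, h2 ▸ (JoinSet.singleton e).symm⟩
  · exact absurd (by simp [h1, h2]) hne

/-- From every odd vertex of `S` a join inside `S` leads to another odd vertex. -/
theorem exists_joinSet_of_odd (S : Finset ε) (c : V) (hc : degTwo p q S c ≠ 0) :
    ∃ d, d ≠ c ∧ degTwo p q S d ≠ 0 ∧ ∃ S₁ ⊆ S, JoinSet p q S₁ c d := by
  induction S using Finset.strongInduction generalizing c with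
  | H S ih =>
    obtain ⟨f, hf, u, huc, hj⟩ := exists_mem_of_degTwo_ne_zero hc
    have hdeg : ∀ v, degTwo p q S v =
        degTwo p q (S.erase f) v + ((if c = v then 1 else 0) + (if u = v then 1 else 0)) := by
      intro v
      have h1 := hj.degTwo_eq v
      unfold degTwo at h1 ⊢
      rw [← h1, Finset.sum_singleton, Finset.sum_erase_add _ _ hf]
    by_cases hu : degTwo p q S u = 0
    · have hu' : degTwo p q (S.erase f) u ≠ 0 := by
        intro h0
        have := hdeg u
        rw [hu, h0] at this
        simp [huc.symm] at this
      obtain ⟨d, hdu, hd, S₁, hS₁, hJ⟩ := ih _ (Finset.erase_ssubset hf) u hu'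
      have hcS : degTwo p q (S.erase f) c = 0 := by
        have h1 := hdeg c
        simp only [if_true, if_neg huc, add_zero] at h1
        have h2 : ∀ x y : ZMod 2, x ≠ 0 → x = y + 1 → y = 0 := by decide
        exact h2 _ _ hc h1
      have hdc : d ≠ c := by rintro rfl; exact hd hcS
      refine ⟨d, hdc, ?_, {f} ∪ S₁, ?_, hj.union hJ ?_⟩
      · rw [hdeg d, if_neg hdc.symm, if_neg hdu.symm]; simpa using hd
      · exact Finset.union_subset (by simpa using hf) (hS₁.trans (Finset.erase_subset _ _))
      · rw [Finset.disjoint_singleton_left]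
        exact fun h => (Finset.mem_erase.mp (hS₁ h)).1 rfl
    · exact ⟨u, huc, hu, {f}, by simpa using hf, hj⟩

end Joins

section Conservative
variable {V ε : Type} {p q : ε → V}

theorem JoinSet.of_eq {e : ε} {a b : V} (h : s(p e, q e) = s(a, b)) : JoinSet p q {e} a b := by
  rcases Sym2.eq_iff.mp h with ⟨h1, h2⟩ | ⟨h1, h2⟩
  · exact h1 ▸ h2 ▸ JoinSet.singleton e
  · exact h1 ▸ h2 ▸ (JoinSet.singleton e).symm

theorem EvenSet.joinSet {S : Finset ε} (h : EvenSet p q S) (a : V) : JoinSet p q S a a :=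
  fun U => by rw [h U, ZMod.two_self_add]

theorem exists_link_of_degTwo_ne_zero {S : Finset ε} {v : V} (h : degTwo p q S v ≠ 0) :
    ∃ e ∈ S, ∃ u, u ≠ v ∧ s(p e, q e) = s(v, u) := by
  obtain ⟨e, he, hne⟩ := Finset.exists_ne_zero_of_sum_ne_zero h
  refine ⟨e, he, ?_⟩
  by_cases h1 : p e = v <;> by_cases h2 : q e = v
  · exact absurd (by simp [h1, h2, ZMod.two_self_add]) hne
  · exact ⟨q e, h2, by rw [h1]⟩
  · exact ⟨p e, h1, by rw [h2, Sym2.eq_swap]⟩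
  · exact absurd (by simp [h1, h2]) hne

theorem degTwo_sdiff_add {S T : Finset ε} (h : T ⊆ S) (v : V) :
    degTwo p q (S \ T) v + degTwo p q T v = degTwo p q S v :=
  Finset.sum_sdiff h

/-- A join of least weight and, among those, of least cardinality. -/
theorem exists_min_joinSet [Nonempty V] (p q : ε → V) (A : Finset ε) (w : ε → ℤ) :
    ∃ P ⊆ A, ∃ x t, JoinSet p q P x t ∧ ∀ S ⊆ A, ∀ a b, JoinSet p q S a b →
      ∑ e ∈ P, w e ≤ ∑ e ∈ S, w e ∧ (S.card < P.card → ∑ e ∈ P, w e < ∑ e ∈ S, w e) := by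
  obtain ⟨v⟩ := ‹Nonempty V›
  obtain ⟨P, hP, hmin⟩ := Finset.exists_min_image
    (A.powerset.filter fun S => ∃ a b, JoinSet p q S a b)
    (fun S => toLex (∑ e ∈ S, w e, S.card)) ⟨∅, by
      simp only [Finset.mem_filter, Finset.empty_mem_powerset, true_and]
      exact ⟨v, v, fun U => by simp [ZMod.two_self_add]⟩⟩
  simp only [Finset.mem_filter, Finset.mem_powerset] at hP hmin
  obtain ⟨hPA, x, t, hxt⟩ := hP
  refine ⟨P, hPA, x, t, hxt, fun S hS a b hab => ?_⟩
  have := hmin S ⟨hS, a, b, hab⟩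
  rw [Prod.Lex.le_iff] at this
  simp only [ofLex_toLex] at this
  rcases this with h | ⟨h, hcard⟩
  · exact ⟨h.le, fun _ => h⟩
  · exact ⟨h.le, fun hlt => absurd hlt (not_lt.mpr hcard)⟩

/-- In a bipartite graph with conservative `±1` weights and some negative edge there is a vertex
with exactly one negative edge such that contracting its star keeps the weights conservative. -/
theorem exists_contractible_star (A : Finset ε) (w : ε → ℤ) (hw : ∀ e, w e = 1 ∨ w e = -1)
    (col : V → ZMod 2) (hcol : ∀ e ∈ A, col (p e) + col (q e) = 1)
    (hcons : ∀ S ⊆ A, EvenSet p q S → 0 ≤ ∑ e ∈ S, w e) {f₀ : ε} (hf₀ : f₀ ∈ A)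
    (hwf₀ : w f₀ = -1) :
    ∃ t : V, ∃ f ∈ A, w f = -1 ∧ (∃ u, s(p f, q f) = s(t, u)) ∧
      (∀ g ∈ A, w g = -1 → (∃ u, s(p g, q g) = s(t, u)) → g = f) ∧
      ∀ Q ⊆ A, (∀ e ∈ Q, p e ≠ t ∧ q e ≠ t) → ∀ c d ec ed, ec ∈ A → ed ∈ A →
        s(p ec, q ec) = s(t, c) → s(p ed, q ed) = s(t, d) → JoinSet p q Q c d →
        0 ≤ ∑ e ∈ Q, w e := by
  have : Nonempty V := ⟨p f₀⟩
  have hlink : ∀ e ∈ A, ∀ a b, s(p e, q e) = s(a, b) → b ≠ a := by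
    rintro e he a _ h rfl
    rcases Sym2.eq_iff.mp h with ⟨h1, h2⟩ | ⟨h1, h2⟩ <;>
    · have := hcol e he
      rw [h1, h2, ZMod.two_self_add] at this
      exact absurd this (by decide)
  obtain ⟨P, hPA, x, t, hP, hmin⟩ := exists_min_joinSet p q A w
  have hsub : ∀ {S : Finset ε}, S ⊆ P → ∑ e ∈ P \ S, w e = ∑ e ∈ P, w e - ∑ e ∈ S, w e := by
    intro S hS
    rw [← Finset.sum_sdiff hS]; ring
  have hcard : ∀ {S R : Finset ε}, S ⊆ R → S.Nonempty → (R \ S).card < R.card := by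
    intro S R hS hne
    exact Finset.card_lt_card (Finset.sdiff_ssubset hS hne)
  have hPneg : ∑ e ∈ P, w e < 0 := by
    have := (hmin {f₀} (by simpa using hf₀) _ _ (JoinSet.singleton f₀)).1
    simp [hwf₀] at this
    linarith
  have hxt : x ≠ t := by
    rintro rfl
    exact absurd (hcons P hPA hP.even) (not_le.mpr hPneg)
  have hacyc : ∀ C ⊆ P, EvenSet p q C → C = ∅ := by
    intro C hC hev
    by_contra hne
    have hne' := Finset.nonempty_iff_ne_empty.mpr hne
    have h1 := (hmin (P \ C) (Finset.sdiff_subset.trans hPA) _ _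
      (hP.sdiff (hev.joinSet x) hC)).2 (hcard hC hne')
    rw [hsub hC] at h1
    linarith [hcons C (hC.trans hPA) hev]
  have hPdeg : ∀ v, degTwo p q P v = (if x = v then 1 else 0) + (if t = v then 1 else 0) :=
    hP.degTwo_eq
  have hPt : degTwo p q P t ≠ 0 := by rw [hPdeg]; simp [hxt]
  obtain ⟨f, hfP, a, hat, hfa⟩ := exists_link_of_degTwo_ne_zero hPt
  have hPstar : ∀ g ∈ P, ∀ c, s(p g, q g) = s(t, c) → w g = -1 := by
    intro g hg c hgc
    have hs : {g} ⊆ P := by simpa using hg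
    have h1 := (hmin (P \ {g}) (Finset.sdiff_subset.trans hPA) _ _
      (hP.symm.sdiff (JoinSet.of_eq hgc) hs)).2 (hcard hs (by simp))
    rw [hsub hs, Finset.sum_singleton] at h1
    rcases hw g with h | h
    · omega
    · exact h
  have hstarP : ∀ g ∈ A, w g = -1 → ∀ c, s(p g, q g) = s(t, c) → g ∈ P := by
    intro g hg hwg c hgc
    by_contra hgP
    have hd : Disjoint P {g} := by simpa using hgP
    have h1 := (hmin (P ∪ {g}) (Finset.union_subset hPA (by simpa using hg)) _ _
      (hP.union (JoinSet.of_eq hgc) hd)).1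
    rw [Finset.sum_union hd, Finset.sum_singleton, hwg] at h1
    omega
  refine ⟨t, f, hPA hfP, hPstar f hfP a hfa, ⟨a, hfa⟩, ?_, ?_⟩
  · rintro g hgA hwg ⟨c, hgc⟩
    have hgP := hstarP g hgA hwg c hgc
    have hct := hlink g hgA t c hgc
    by_contra hgf
    have hfs : {f} ⊆ P := by simpa using hfP
    have hgs : {g} ⊆ P \ {f} := by simpa [hgf] using hgP
    have h1 : ∀ v, degTwo p q (P \ {f}) v = (if a = v then 1 else 0) + (if x = v then 1 else 0) :=
      (hP.symm.sdiff (JoinSet.of_eq hfa) hfs).degTwo_eq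
    have h2 : ∀ v, degTwo p q ((P \ {f}) \ {g}) v +
        ((if t = v then 1 else 0) + (if c = v then 1 else 0)) =
        (if a = v then 1 else 0) + (if x = v then 1 else 0) := by
      intro v
      rw [← h1, ← degTwo_sdiff_add hgs, (JoinSet.of_eq hgc).degTwo_eq]
    have h3 : degTwo p q ((P \ {f}) \ {g}) t ≠ 0 := by
      intro h0
      have := h2 t
      simp [h0, hat, hxt, hct] at this
    obtain ⟨d, hdt, hd, S₁, hS₁, hJ⟩ := exists_joinSet_of_odd _ _ h3
    have hS₁P : S₁ ⊆ P := hS₁.trans (Finset.sdiff_subset.trans Finset.sdiff_subset)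
    have hfS₁ : f ∉ S₁ := fun h => by have := hS₁ h; simp at this
    have hgS₁ : g ∉ S₁ := fun h => by have := hS₁ h; simp at this
    have hd' : d = a ∨ d = c ∨ d = x := by
      by_contra hcon
      push Not at hcon
      have := h2 d
      simp [hdt.symm, hcon.1.symm, hcon.2.1.symm, hcon.2.2.symm] at this
      exact hd this
    rcases hd' with rfl | rfl | rfl
    · have hdis : Disjoint S₁ {f} := by simpa using hfS₁
      have := hacyc (S₁ ∪ {f}) (Finset.union_subset hS₁P hfs)
        (hJ.union (JoinSet.of_eq hfa).symm hdis).even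
      simp at this
    · have hdis : Disjoint S₁ {g} := by simpa using hgS₁
      have := hacyc (S₁ ∪ {g}) (Finset.union_subset hS₁P (by simpa using hgP))
        (hJ.union (JoinSet.of_eq hgc).symm hdis).even
      simp at this
    · have := hacyc (P \ S₁) Finset.sdiff_subset (hP.sdiff hJ.symm hS₁P).even
      have h4 : f ∈ P \ S₁ := Finset.mem_sdiff.mpr ⟨hfP, hfS₁⟩
      simp [this] at h4
  · intro Q
    induction Q using Finset.strongInduction with
    | H Q ih =>
    intro hQA hQt c d ec ed hec hed hecc hedd hQ
    by_contra! hneg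
    have hcd : c ≠ d := by
      rintro rfl
      exact absurd (hcons Q hQA hQ.even) (not_le.mpr hneg)
    have hQacyc : ∀ C ⊆ Q, EvenSet p q C → C = ∅ := by
      intro C hC hev
      by_contra hne
      have hne' := Finset.nonempty_iff_ne_empty.mpr hne
      have h1 := ih (Q \ C) (Finset.sdiff_ssubset hC hne') (Finset.sdiff_subset.trans hQA)
        (fun e he => hQt e (Finset.sdiff_subset he)) c d ec ed hec hed hecc hedd
        (hQ.sdiff (hev.joinSet c) hC)
      have h2 := hcons C (hC.trans hQA) hev
      rw [← Finset.sum_sdiff hC] at hneg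
      linarith
    have hcoln : ∀ e ∈ A, ∀ u, s(p e, q e) = s(t, u) → col t + col u = 1 := by
      intro e he u h
      rcases Sym2.eq_iff.mp h with ⟨h1, h2⟩ | ⟨h1, h2⟩
      · rw [← h1, ← h2]; exact hcol e he
      · rw [← h1, ← h2, add_comm]; exact hcol e he
    have hQeven : (2 : ℤ) ∣ ∑ e ∈ Q, w e := by
      have h1 : ∑ e ∈ Q, (col (p e) + col (q e)) = ∑ e ∈ Q, (1 : ZMod 2) :=
        Finset.sum_congr rfl fun e he => hcol e (hQA he)
      have h2 : col c + col d = 0 := by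
        linear_combination hcoln ec hec c hecc + hcoln ed hed d hedd - ZMod.two_self_add (col t) +
          ZMod.two_self_add 1
      rw [hQ col, h2] at h1
      refine (ZMod.intCast_zmod_eq_zero_iff_dvd _ 2).mp ?_
      rw [Int.cast_sum, h1]
      refine Finset.sum_congr rfl fun e _ => ?_
      rcases hw e with h | h <;> rw [h] <;> decide
    have hecQ : ec ∉ Q := fun h => by
      rcases Sym2.eq_iff.mp hecc with ⟨h1, h2⟩ | ⟨h1, h2⟩
      · exact (hQt _ h).1 h1
      · exact (hQt _ h).2 h2
    have hedQ : ed ∉ Q := fun h => by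
      rcases Sym2.eq_iff.mp hedd with ⟨h1, h2⟩ | ⟨h1, h2⟩
      · exact (hQt _ h).1 h1
      · exact (hQt _ h).2 h2
    have heced : ec ≠ ed := by
      rintro rfl
      rw [hecc] at hedd
      exact hcd (Sym2.congr_right.mp hedd)
    have hd1 : Disjoint {ec} Q := by simpa using hecQ
    have hd2 : Disjoint ({ec} ∪ Q) {ed} := by
      simp [hedQ, heced.symm]
    have hsum := hcons _ (Finset.union_subset (Finset.union_subset (by simpa using hec) hQA)
      (by simpa using hed))
      ((((JoinSet.of_eq hecc).union hQ hd1).union (JoinSet.of_eq hedd).symm hd2)).even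
    rw [Finset.sum_union hd2, Finset.sum_union hd1, Finset.sum_singleton,
      Finset.sum_singleton] at hsum
    have hwec : w ec = 1 := by
      rcases hw ec with h | h
      · exact h
      · rcases hw ed with h' | h' <;> omega
    have hwed : w ed = 1 := by
      rcases hw ed with h | h
      · exact h
      · omega
    have hQ2 : ∑ e ∈ Q, w e = -2 := by omega
    have hecP : ec ∉ P := fun h => by have := hPstar ec h c hecc; omega
    have hedP : ed ∉ P := fun h => by have := hPstar ed h d hedd; omega
    have hmeet : P ∩ Q ≠ ∅ := by
      intro h0
      have hd3 : Disjoint P {ec} := by simpa using hecP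
      have hd4 : Disjoint (P ∪ {ec}) Q := by
        rw [Finset.disjoint_union_left]
        exact ⟨Finset.disjoint_iff_inter_eq_empty.mpr h0, hd1⟩
      have h1 := (hmin (P ∪ {ec} ∪ Q)
        (Finset.union_subset (Finset.union_subset hPA (by simpa using hec)) hQA) _ _
        ((hP.union (JoinSet.of_eq hecc) hd3).union hQ hd4)).1
      rw [Finset.sum_union hd4, Finset.sum_union hd3, Finset.sum_singleton, hwec, hQ2] at h1
      omega
    have hsplit : ∀ v, degTwo p q (P \ Q) v + degTwo p q (P ∩ Q) v = degTwo p q P v := by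
      intro v
      rw [← degTwo_sdiff_add (Finset.inter_subset_left (s₁ := P) (s₂ := Q)),
        Finset.sdiff_inter_self_left]
    have hQt0 : degTwo p q (P ∩ Q) t = 0 :=
      Finset.sum_eq_zero fun e he => by
        have := hQt e (Finset.inter_subset_right he)
        simp [this.1, this.2]
    have hPQt : degTwo p q (P \ Q) t ≠ 0 := by
      have := hsplit t
      rw [hQt0, add_zero] at this
      rwa [this]
    obtain ⟨y, hyt, hy, S₁, hS₁, hJ⟩ := exists_joinSet_of_odd _ _ hPQt
    have hS₁P : S₁ ⊆ P := hS₁.trans Finset.sdiff_subset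
    have hS₁Q : Disjoint S₁ Q := Finset.disjoint_of_subset_left hS₁ Finset.sdiff_disjoint
    have hS₁ne : S₁.Nonempty := by
      rw [Finset.nonempty_iff_ne_empty]
      rintro rfl
      have := hJ.degTwo_eq t
      simp [degTwo, hyt] at this
    have hS₁neg : ∑ e ∈ S₁, w e < 0 := by
      have h1 := (hmin (P \ S₁) (Finset.sdiff_subset.trans hPA) _ _
        (hP.symm.sdiff hJ hS₁P)).2 (hcard hS₁P hS₁ne)
      rw [hsub hS₁P] at h1
      linarith
    have hmain : ∃ Q₁ ⊆ Q, JoinSet p q Q₁ c y := by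
      by_cases hyc : y = c
      · exact ⟨∅, by simp, fun U => by simp [hyc, ZMod.two_self_add]⟩
      by_cases hyd : y = d
      · exact ⟨Q, subset_rfl, hyd ▸ hQ⟩
      have hPQy : degTwo p q (P ∩ Q) y ≠ 0 := by
        intro h0
        have h1 := hsplit y
        rw [h0, add_zero] at h1
        rw [h1, hPdeg, if_neg hyt.symm, add_zero] at hy
        have hxy : x = y := by
          by_contra h
          exact hy (if_neg h)
        subst hxy
        have h2 := hacyc (P \ S₁) Finset.sdiff_subset (hP.sdiff hJ.symm hS₁P).even
        apply hmeet
        rw [Finset.sdiff_eq_empty_iff_subset] at h2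
        exact Finset.disjoint_iff_inter_eq_empty.mp (Finset.disjoint_of_subset_left h2 hS₁Q)
      obtain ⟨g, hg, z, hzy, hgz⟩ := exists_link_of_degTwo_ne_zero hPQy
      have hgQ := Finset.inter_subset_right hg
      have hgs : {g} ⊆ Q := by simpa using hgQ
      have h2 : ∀ v, degTwo p q (Q \ {g}) v +
          ((if y = v then 1 else 0) + (if z = v then 1 else 0)) =
          (if c = v then 1 else 0) + (if d = v then 1 else 0) := by
        intro v
        rw [← hQ.degTwo_eq, ← degTwo_sdiff_add hgs, (JoinSet.of_eq hgz).degTwo_eq]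
      have h3 : degTwo p q (Q \ {g}) y ≠ 0 := by
        intro h0
        have := h2 y
        simp [h0, hzy, Ne.symm hyc, Ne.symm hyd] at this
      obtain ⟨d', hdy, hd', Q₁, hQ₁, hJ₁⟩ := exists_joinSet_of_odd _ _ h3
      have hQ₁Q := hQ₁.trans Finset.sdiff_subset
      have hgQ₁ : g ∉ Q₁ := fun h => by have := hQ₁ h; simp at this
      have hd'' : d' = c ∨ d' = d ∨ d' = z := by
        by_contra hcon
        push Not at hcon
        have := h2 d'
        simp [hdy.symm, hcon.1.symm, hcon.2.1.symm, hcon.2.2.symm] at this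
        exact hd' this
      rcases hd'' with rfl | rfl | rfl
      · exact ⟨Q₁, hQ₁Q, hJ₁.symm⟩
      · exact ⟨Q \ Q₁, Finset.sdiff_subset, (hQ.symm.sdiff hJ₁.symm hQ₁Q).symm⟩
      · have hdis : Disjoint Q₁ {g} := by simpa using hgQ₁
        have := hQacyc (Q₁ ∪ {g}) (Finset.union_subset hQ₁Q hgs)
          (hJ₁.union (JoinSet.of_eq hgz).symm hdis).even
        simp at this
    obtain ⟨Q₁, hQ₁, hQ₁J⟩ := hmain
    have key : ∀ R ⊆ Q, ∀ v ev, ev ∈ A → ev ∉ P → ev ∉ Q → w ev = 1 → s(p ev, q ev) = s(t, v) →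
        JoinSet p q R y v → 0 ≤ ∑ e ∈ S₁, w e + ∑ e ∈ R, w e + 1 := by
      intro R hR v ev hev hevP hevQ hwev hl hRJ
      have hd5 : Disjoint S₁ R := Finset.disjoint_of_subset_right hR hS₁Q
      have hd6 : Disjoint (S₁ ∪ R) {ev} := by
        rw [Finset.disjoint_singleton_right, Finset.mem_union]
        rintro (h | h)
        · exact hevP (hS₁P h)
        · exact hevQ (hR h)
      have := hcons (S₁ ∪ R ∪ {ev}) (Finset.union_subset
        (Finset.union_subset (hS₁P.trans hPA) (hR.trans hQA)) (by simpa using hev))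
        ((hJ.union hRJ hd5).union (JoinSet.of_eq hl).symm hd6).even
      rwa [Finset.sum_union hd6, Finset.sum_union hd5, Finset.sum_singleton, hwev] at this
    have k1 := key Q₁ hQ₁ c ec hec hecP hecQ hwec hecc hQ₁J.symm
    have k2 := key (Q \ Q₁) Finset.sdiff_subset d ed hed hedP hedQ hwed hedd
      (hQ.sdiff hQ₁J hQ₁)
    have k3 := Finset.sum_sdiff (f := w) hQ₁
    omega

end Conservative

section Height
variable {V ε : Type}

theorem evenSet_of_degTwo_eq_zero {p q : ε → V} {S : Finset ε} (h : ∀ v, degTwo p q S v = 0) :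
    EvenSet p q S := by
  intro U
  set W := S.image p ∪ S.image q with hW
  have h1 : ∀ e ∈ S, U (p e) + U (q e) = ∑ v ∈ W, U v *
      ((if p e = v then 1 else 0) + (if q e = v then 1 else 0)) := by
    intro e he
    have hp : p e ∈ W := Finset.mem_union_left _ (Finset.mem_image_of_mem _ he)
    have hq : q e ∈ W := Finset.mem_union_right _ (Finset.mem_image_of_mem _ he)
    simp [mul_add, Finset.sum_add_distrib, hp, hq]
  rw [Finset.sum_congr rfl h1, Finset.sum_comm]
  refine Finset.sum_eq_zero fun v _ => ?_
  rw [← Finset.mul_sum]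
  exact mul_eq_zero_of_right _ (h v)

/-- `x` and `y` are joined by edges of `A` inside the sublevel set `{h ≤ i}`. -/
def LevelConn (p q : ε → V) (A : Finset ε) (h : V → ℤ) (i : ℤ) (x y : V) : Prop :=
  ∀ U : V → ZMod 2, (∀ e ∈ A, h (p e) ≤ i → h (q e) ≤ i → U (p e) = U (q e)) → U x = U y

/-- The endpoint of smaller height. -/
def lowEnd (p q : ε → V) (h : V → ℤ) (e : ε) : V := if h (p e) ≤ h (q e) then p e else q e

theorem lowEnd_eq_or (p q : ε → V) (h : V → ℤ) (e : ε) :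
    lowEnd p q h e = p e ∨ lowEnd p q h e = q e := by
  unfold lowEnd; split_ifs <;> simp

theorem height_lowEnd (p q : ε → V) (h : V → ℤ) (e : ε) :
    h (lowEnd p q h e) = min (h (p e)) (h (q e)) := by
  unfold lowEnd; split_ifs with h1 <;> omega

/-- Conservative `±1` weights on a bipartite graph have a height function, changing by one along
every edge, such that each component of a sublevel set has at most one negative edge leaving it. -/
theorem exists_height (w : ε → ℤ) (hw : ∀ e, w e = 1 ∨ w e = -1) (A : Finset ε) (p q : ε → V)
    (hcol : ∃ col : V → ZMod 2, ∀ e ∈ A, col (p e) + col (q e) = 1)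
    (hcons : ∀ S ⊆ A, EvenSet p q S → 0 ≤ ∑ e ∈ S, w e) :
    ∃ h : V → ℤ, (∀ e ∈ A, |h (p e) - h (q e)| = 1) ∧
      ∀ e ∈ A, ∀ e' ∈ A, w e = -1 → w e' = -1 →
        h (lowEnd p q h e) = h (lowEnd p q h e') →
        LevelConn p q A h (h (lowEnd p q h e)) (lowEnd p q h e) (lowEnd p q h e') → e = e' := by
  induction A using Finset.strongInduction generalizing p q with
  | H A ih =>
  obtain ⟨col, hcol⟩ := hcol
  by_cases hneg : ∃ f₀ ∈ A, w f₀ = -1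
  swap
  · push Not at hneg
    refine ⟨fun v => if col v = 0 then 0 else 1, fun e he => ?_, fun e he e' _ h => ?_⟩
    · have key : ∀ x y : ZMod 2, x + y = 1 →
          |(if x = 0 then (0 : ℤ) else 1) - (if y = 0 then 0 else 1)| = 1 := by decide
      exact key _ _ (hcol e he)
    · exact absurd h (hneg e he)
  obtain ⟨f₀, hf₀, hwf₀⟩ := hneg
  obtain ⟨t, f, hfA, hwf, ⟨uf, hfu⟩, huniq, hstar⟩ :=
    exists_contractible_star A w hw col hcol hcons hf₀ hwf₀
  set N : Set V := {u | ∃ g ∈ A, s(p g, q g) = s(t, u)} with hN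
  set π : V → V := fun v => if v ∈ N then t else v with hπ
  have hlk : ∀ g ∈ A, ∀ u, s(p g, q g) = s(t, u) → col u = col t + 1 := by
    intro e he u h
    have h3 : col t + col u = 1 := by
      rcases Sym2.eq_iff.mp h with ⟨h1, h2⟩ | ⟨h1, h2⟩
      · rw [← h1, ← h2]; exact hcol e he
      · rw [← h1, ← h2, add_comm]; exact hcol e he
    linear_combination h3 - ZMod.two_self_add (col t)
  have htN : t ∉ N := by
    rintro ⟨g, hg, h⟩
    have := hlk g hg t h
    simp at this
  have hπt : π t = t := if_neg htN
  set A' := A.filter fun e => p e ≠ t ∧ q e ≠ t with hA'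
  have hA'A : A' ⊆ A := Finset.filter_subset _ _
  have hinc : ∀ g ∈ A, g ∉ A' → ∃ u ∈ N, s(p g, q g) = s(t, u) := by
    intro g hg hg'
    have : p g = t ∨ q g = t := by
      by_contra hcon
      push Not at hcon
      exact hg' (Finset.mem_filter.mpr ⟨hg, hcon⟩)
    rcases this with h | h
    · have h1 : s(p g, q g) = s(t, q g) := by rw [h]
      exact ⟨q g, ⟨g, hg, h1⟩, h1⟩
    · have h1 : s(p g, q g) = s(t, p g) := by rw [h, Sym2.eq_swap]
      exact ⟨p g, ⟨g, hg, h1⟩, h1⟩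
  have hfA' : f ∉ A' := by
    intro hf
    have hf' := (Finset.mem_filter.mp hf).2
    rcases Sym2.eq_iff.mp hfu with ⟨h1, _⟩ | ⟨_, h1⟩
    · exact hf'.1 h1
    · exact hf'.2 h1
  have hss : A' ⊂ A := Finset.ssubset_iff_subset_ne.mpr
    ⟨hA'A, fun h => hfA' (h ▸ hfA)⟩
  have hcons' : ∀ S ⊆ A', EvenSet (π ∘ p) (π ∘ q) S → 0 ≤ ∑ e ∈ S, w e := by
    intro S
    induction S using Finset.strongInduction with
    | H S ihS =>
    intro hS hev
    have hSt : ∀ e ∈ S, p e ≠ t ∧ q e ≠ t := fun e he => (Finset.mem_filter.mp (hS he)).2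
    by_cases hall : ∀ v, degTwo p q S v = 0
    · exact hcons S (hS.trans hA'A) (evenSet_of_degTwo_eq_zero hall)
    push Not at hall
    have hoddN : ∀ v, degTwo p q S v ≠ 0 → v ∈ N := by
      intro v hv
      by_contra hvN
      have hvt : v ≠ t := by
        rintro rfl
        exact hv (Finset.sum_eq_zero fun e he => by simp [hSt e he])
      apply hv
      have h1 := hev (fun x => if x = v then 1 else 0)
      rw [← h1]
      refine Finset.sum_congr rfl fun e _ => ?_
      have h2 : ∀ x, (π x = v) = (x = v) := by
        intro x
        by_cases hx : x ∈ N
        · have h3 : π x = t := if_pos hx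
          rw [h3, eq_iff_iff]
          exact ⟨fun h => absurd h.symm hvt, fun h => absurd (h ▸ hx) hvN⟩
        · rw [show π x = x from if_neg hx]
      simp only [Function.comp_apply, h2]
    obtain ⟨c, hc⟩ := hall
    obtain ⟨d, hdc, hd, S₁, hS₁, hJ⟩ := exists_joinSet_of_odd S c hc
    obtain ⟨ec, hec, hecc⟩ := hoddN c hc
    obtain ⟨ed, hed, hedd⟩ := hoddN d hd
    have hw1 := hstar S₁ (hS₁.trans (hS.trans hA'A)) (fun e he => hSt e (hS₁ he)) c d ec ed
      hec hed hecc hedd hJ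
    have hev1 : EvenSet (π ∘ p) (π ∘ q) S₁ := by
      intro U
      have h1 := hJ (U ∘ π)
      have h2 : π c = t := if_pos (hoddN c hc)
      have h3 : π d = t := if_pos (hoddN d hd)
      simp only [Function.comp_apply, h2, h3, ZMod.two_self_add] at h1 ⊢
      exact h1
    have hne : S₁.Nonempty := by
      rw [Finset.nonempty_iff_ne_empty]
      rintro rfl
      have := hJ.degTwo_eq c
      simp [degTwo, hdc] at this
    have h4 := ihS (S \ S₁) (Finset.sdiff_ssubset hS₁ hne) (Finset.sdiff_subset.trans hS)
      (((hev.joinSet t).sdiff (hev1.joinSet t) hS₁).even)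
    rw [← Finset.sum_sdiff hS₁]
    linarith
  obtain ⟨h', hstep', huniq'⟩ := ih A' hss (π ∘ p) (π ∘ q) ⟨fun v => if v = t then col t + 1 else
    col v, by
      intro e he
      have h1 := (Finset.mem_filter.mp he).2
      have h2 : ∀ v, v ≠ t → (if π v = t then col t + 1 else col (π v)) = col v := by
        intro v hv
        by_cases hvN : v ∈ N
        · rw [show π v = t from if_pos hvN, if_pos rfl]
          obtain ⟨g, hg, hgv⟩ := hvN
          exact (hlk g hg v hgv).symm
        · rw [show π v = v from if_neg hvN, if_neg hv]
      simp only [Function.comp_apply]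
      rw [h2 _ h1.1, h2 _ h1.2]
      exact hcol e (hA'A he)⟩ hcons'
  set h : V → ℤ := fun v => if v = t then h' t - 1 else h' (π v) with hh
  have hht : h t = h' t - 1 := if_pos rfl
  have hhv : ∀ v, v ≠ t → h v = h' (π v) := fun v hv => if_neg hv
  have hhN : ∀ u ∈ N, h u = h' t := by
    intro u hu
    have : u ≠ t := fun h => htN (h ▸ hu)
    rw [hhv u this, show π u = t from if_pos hu]
  have hlow' : ∀ e ∈ A', h (lowEnd p q h e) = h' (lowEnd (π ∘ p) (π ∘ q) h' e) ∧
      π (lowEnd p q h e) = lowEnd (π ∘ p) (π ∘ q) h' e ∧ lowEnd p q h e ≠ t := by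
    intro e he
    have h1 := (Finset.mem_filter.mp he).2
    unfold lowEnd
    simp only [hhv _ h1.1, hhv _ h1.2, Function.comp_apply]
    split_ifs
    · exact ⟨hhv _ h1.1, rfl, h1.1⟩
    · exact ⟨hhv _ h1.2, rfl, h1.2⟩
  have hlowf : lowEnd p q h f = t := by
    have hufN : uf ∈ N := ⟨f, hfA, hfu⟩
    unfold lowEnd
    rcases Sym2.eq_iff.mp hfu with ⟨h1, h2⟩ | ⟨h1, h2⟩
    · rw [h1, h2, if_pos (by rw [hht, hhN uf hufN]; omega)]
    · rw [h1, h2, if_neg (by rw [hht, hhN uf hufN]; omega)]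
  have hnegA' : ∀ e ∈ A, w e = -1 → e ≠ f → e ∈ A' := by
    intro e he hwe hef
    by_contra hcon
    obtain ⟨u, _, hu⟩ := hinc e he hcon
    exact hef (huniq e he hwe ⟨u, hu⟩)
  have hsep : ∀ y, y ≠ t → ¬ (LevelConn p q A h (h t) t y ∨ LevelConn p q A h (h t) y t) := by
    intro y hy hcon
    have h1 : ∀ e ∈ A, h (p e) ≤ h t → h (q e) ≤ h t →
        (if p e = t then (1 : ZMod 2) else 0) = if q e = t then 1 else 0 := by
      intro e he hpe hqe
      by_cases heA : e ∈ A'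
      · have := (Finset.mem_filter.mp heA).2
        rw [if_neg this.1, if_neg this.2]
      · obtain ⟨u, huN, hu⟩ := hinc e he heA
        have h2 := hhN u huN
        rcases Sym2.eq_iff.mp hu with ⟨h3, h4⟩ | ⟨h3, h4⟩
        · rw [h4] at hqe; omega
        · rw [h3] at hpe; omega
    rcases hcon with hcon | hcon
    · have := hcon (fun v => if v = t then 1 else 0) h1
      simp [hy] at this
    · have := hcon (fun v => if v = t then 1 else 0) h1
      simp [hy] at this
  refine ⟨h, ?_, ?_⟩
  · intro e he
    by_cases heA : e ∈ A'
    · have h1 := (Finset.mem_filter.mp heA).2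
      rw [hhv _ h1.1, hhv _ h1.2]
      exact hstep' e heA
    · obtain ⟨u, huN, hu⟩ := hinc e he heA
      have h2 := hhN u huN
      rcases Sym2.eq_iff.mp hu with ⟨h3, h4⟩ | ⟨h3, h4⟩
      · rw [h3, h4, h2, hht]; simp
      · rw [h3, h4, h2, hht]; simp
  · intro e he e' he' hwe hwe' hlevel hconn
    by_cases hef : e = f
    · subst hef
      by_contra hne
      obtain ⟨_, _, h3⟩ := hlow' e' (hnegA' e' he' hwe' (Ne.symm hne))
      rw [hlowf] at hconn
      exact hsep _ h3 (Or.inl hconn)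
    by_cases hef' : e' = f
    · subst hef'
      obtain ⟨_, _, h3⟩ := hlow' e (hnegA' e he hwe hef)
      rw [hlevel, hlowf] at hconn
      exact absurd (Or.inr hconn) (hsep _ h3)
    have heA := hnegA' e he hwe hef
    have heA' := hnegA' e' he' hwe' hef'
    obtain ⟨h1, h2, _⟩ := hlow' e heA
    obtain ⟨h1', h2', _⟩ := hlow' e' heA'
    refine huniq' e heA e' heA' hwe hwe' (by rw [← h1, ← h1', hlevel]) ?_
    intro U hU
    rw [← h2, ← h2']
    refine hconn (U ∘ π) ?_
    intro g hg hpg hqg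
    by_cases hgA : g ∈ A'
    · have h3 := (Finset.mem_filter.mp hgA).2
      rw [hhv _ h3.1, h1] at hpg
      rw [hhv _ h3.2, h1] at hqg
      exact hU g hgA hpg hqg
    · obtain ⟨u, huN, hu⟩ := hinc g hg hgA
      have h4 : π u = t := if_pos huN
      rcases Sym2.eq_iff.mp hu with ⟨h5, h6⟩ | ⟨h5, h6⟩ <;>
        simp only [Function.comp_apply, h5, h6, h4, hπt]

end Height

section Duality
variable {V F ε : Type} [Fintype ε]

/-- A mod-2 vector orthogonal to all cuts that avoid `T` can be changed on `T` so as to become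
orthogonal to all cuts. -/
theorem exists_lift_even (p q : ε → F) (T : Set ε) (s : ε → ZMod 2)
    (h : ∀ U : F → ZMod 2, (∀ e ∈ T, U (p e) = U (q e)) → ∑ e, s e * (U (p e) + U (q e)) = 0) :
    ∃ s' : ε → ZMod 2, (∀ e ∉ T, s' e = s e) ∧
      ∀ U : F → ZMod 2, ∑ e, s' e * (U (p e) + U (q e)) = 0 := by
  let L : (F → ZMod 2) →ₗ[ZMod 2] (ε → ZMod 2) :=
    { toFun := fun U e => if e ∈ T then U (p e) + U (q e) else 0
      map_add' := fun U U' => by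
        funext e
        by_cases he : e ∈ T
        · simp only [he, if_true, Pi.add_apply]; ring
        · simp [he]
      map_smul' := fun c U => by
        funext e
        by_cases he : e ∈ T
        · simp only [he, if_true, Pi.smul_apply, smul_eq_mul, RingHom.id_apply]; ring
        · simp [he] }
  let φ : (F → ZMod 2) →ₗ[ZMod 2] ZMod 2 :=
    { toFun := fun U => ∑ e, s e * (U (p e) + U (q e))
      map_add' := fun U U' => by
        rw [← Finset.sum_add_distrib]
        exact Finset.sum_congr rfl fun e _ => by simp only [Pi.add_apply]; ring
      map_smul' := fun c U => by
        simp only [smul_eq_mul, RingHom.id_apply, Finset.mul_sum]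
        exact Finset.sum_congr rfl fun e _ => by simp only [Pi.smul_apply, smul_eq_mul]; ring }
  have hker : φ ∈ (LinearMap.ker L).dualAnnihilator := by
    rw [Submodule.mem_dualAnnihilator]
    intro U hU
    refine h U fun e he => ?_
    have h1 : L U e = 0 := by rw [LinearMap.mem_ker.mp hU]; rfl
    have h2 : L U e = U (p e) + U (q e) := if_pos he
    exact ZMod.two_eq_of_add_eq_zero (h2 ▸ h1)
  rw [← LinearMap.range_dualMap_eq_dualAnnihilator_ker] at hker
  obtain ⟨ψ, hψ⟩ := hker
  have hψ' : ∀ y : ε → ZMod 2, ψ y = ∑ e, y e * ψ (Pi.single e 1) := by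
    intro y
    have h1 : ψ y = ψ (∑ e, Pi.single e (y e)) := by rw [Finset.univ_sum_single]
    rw [h1, map_sum]
    refine Finset.sum_congr rfl fun e _ => ?_
    rw [← smul_eq_mul, ← map_smul, ← Pi.single_smul, smul_eq_mul, mul_one]
  refine ⟨fun e => s e + if e ∈ T then ψ (Pi.single e 1) else 0, fun e he => by simp [he],
    fun U => ?_⟩
  have h1 : ψ (L U) = φ U := by rw [← hψ]; rfl
  rw [hψ'] at h1
  have h2 : φ U = ∑ e, s e * (U (p e) + U (q e)) := rfl
  have h3 : ∀ e, L U e = if e ∈ T then U (p e) + U (q e) else 0 := fun e => rfl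
  have h4 := ZMod.two_self_add (φ U)
  nth_rewrite 1 [h2] at h4
  rw [← h1, ← Finset.sum_add_distrib] at h4
  refine Eq.trans (Finset.sum_congr rfl fun e _ => ?_) h4
  rw [h3]
  by_cases he : e ∈ T
  · simp only [he, if_true]; ring
  · simp [he]

/-- The multigraph `(p', q')` is an abstract dual of `(p, q)` on the same edge set. -/
def IsDual (p q : ε → V) (p' q' : ε → F) : Prop :=
  ∀ s : ε → ZMod 2, (∀ U : F → ZMod 2, ∑ e, s e * (U (p' e) + U (q' e)) = 0) ↔
    ∃ A : V → ZMod 2, ∀ e, s e = A (p e) + A (q e)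

/-- Minors of graphs with an abstract dual have an abstract dual. -/
theorem IsDual.exists_minor {C F₀ ε₀ : Type} [Fintype ε₀] {p₀ q₀ : ε₀ → C} {p₀' q₀' : ε₀ → F₀}
    (hd : IsDual p₀ q₀ p₀' q₀') (p q : ε → V) (g : ε → ε₀) (hg : Function.Injective g)
    (Z : Set ε₀) (B : V → Set C) (hgZ : ∀ e, g e ∉ Z)
    (hgB : ∀ e, (p₀ (g e) ∈ B (p e) ∧ q₀ (g e) ∈ B (q e)) ∨
      (p₀ (g e) ∈ B (q e) ∧ q₀ (g e) ∈ B (p e)))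
    (hdisj : ∀ v w c, c ∈ B v → c ∈ B w → v = w)
    (hconn : ∀ v, ∀ U : C → ZMod 2, (∀ z ∈ Z, U (p₀ z) = U (q₀ z)) →
      ∀ c ∈ B v, ∀ c' ∈ B v, U c = U c')
    (hZ : ∀ z ∈ Z, ∃ v, p₀ z ∈ B v ∧ q₀ z ∈ B v) :
    ∃ (F : Type) (p' q' : ε → F), IsDual p q p' q' := by
  let T : Set ε₀ := {e | e ∉ Z ∧ e ∉ Set.range g}
  let r : F₀ → F₀ → Prop := fun x y => ∃ e ∈ T, p₀' e = x ∧ q₀' e = y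
  refine ⟨Quot r, fun e => Quot.mk r (p₀' (g e)), fun e => Quot.mk r (q₀' (g e)), fun s => ?_⟩
  have hsum : ∀ f : ε₀ → ZMod 2, (∀ e ∉ Set.range g, f e = 0) → ∑ e, f e = ∑ e, f (g e) := by
    intro f hf
    rw [← Finset.sum_image (s := Finset.univ) (f := f) (g := g) (fun a _ b _ h => hg h)]
    refine (Finset.sum_subset (Finset.subset_univ _) fun e _ he => hf e ?_).symm
    simpa using he
  constructor
  · intro hs
    have hext : ∀ e, Function.extend g s 0 (g e) = s e := fun e => hg.extend_apply _ _ _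
    obtain ⟨s', hs', hev⟩ := exists_lift_even p₀' q₀' T (Function.extend g s 0) (by
      intro U hU
      rw [hsum]
      · have := hs (Quot.lift U (by rintro x y ⟨e, he, rfl, rfl⟩; exact hU e he))
        simpa only [hext] using this
      · intro e he
        rw [Function.extend_apply' _ _ _ (by simpa using he)]
        simp)
    obtain ⟨A, hA⟩ := (hd s').mp hev
    have hAZ : ∀ z ∈ Z, A (p₀ z) = A (q₀ z) := by
      intro z hz
      have h1 : z ∉ Set.range g := by rintro ⟨e, rfl⟩; exact hgZ e hz
      have h2 : s' z = 0 := by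
        rw [hs' z (fun h => h.1 hz), Function.extend_apply' _ _ _ (by simpa using h1)]
        rfl
      exact ZMod.two_eq_of_add_eq_zero ((hA z).symm.trans h2)
    have hval : ∀ v, ∃ x, ∀ c ∈ B v, A c = x := by
      intro v
      rcases (B v).eq_empty_or_nonempty with h | ⟨c, hc⟩
      · exact ⟨0, by simp [h]⟩
      · exact ⟨A c, fun c' hc' => hconn v A hAZ c' hc' c hc⟩
    choose A' hA' using hval
    refine ⟨A', fun e => ?_⟩
    have h1 : s e = s' (g e) := by
      rw [hs' (g e) (fun h => h.2 ⟨e, rfl⟩), hext]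
    rw [h1, hA]
    rcases hgB e with ⟨h2, h3⟩ | ⟨h2, h3⟩
    · rw [hA' _ _ h2, hA' _ _ h3]
    · rw [hA' _ _ h2, hA' _ _ h3, add_comm]
  · rintro ⟨A, hA⟩ U
    let A₀ : C → ZMod 2 := fun c => if h : ∃ v, c ∈ B v then A h.choose else 0
    have hA₀ : ∀ v, ∀ c ∈ B v, A₀ c = A v := by
      intro v c hc
      have h : ∃ v, c ∈ B v := ⟨v, hc⟩
      have : A₀ c = A h.choose := dif_pos h
      rw [this, hdisj _ _ c h.choose_spec hc]
    have := (hd fun e => A₀ (p₀ e) + A₀ (q₀ e)).mpr ⟨A₀, fun e => rfl⟩ fun x => U (Quot.mk r x)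
    rw [hsum] at this
    · rw [← this]
      refine Finset.sum_congr rfl fun e _ => ?_
      rw [hA e]
      rcases hgB e with ⟨h2, h3⟩ | ⟨h2, h3⟩
      · rw [hA₀ _ _ h2, hA₀ _ _ h3]
      · rw [hA₀ _ _ h2, hA₀ _ _ h3, add_comm (A (p e))]
    · intro e he
      by_cases hz : e ∈ Z
      · obtain ⟨v, h2, h3⟩ := hZ e hz
        rw [hA₀ _ _ h2, hA₀ _ _ h3, ZMod.two_self_add, zero_mul]
      · have : Quot.mk r (p₀' e) = Quot.mk r (q₀' e) := Quot.sound ⟨e, ⟨hz, he⟩, rfl, rfl⟩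
        rw [this, ZMod.two_self_add, mul_zero]

end Duality

section Grid

/-- Edges of the `(m + 1) × (m + 1)` grid: horizontal ones, then vertical ones. -/
abbrev GridEdge (m : ℕ) : Type := (Fin m × Fin (m + 1)) ⊕ (Fin (m + 1) × Fin m)

/-- The lower or left end of a grid edge. -/
def gridFst (m : ℕ) : GridEdge m → ℕ × ℕ
  | .inl e => (e.1, e.2)
  | .inr e => (e.1, e.2)

/-- The upper or right end of a grid edge. -/
def gridSnd (m : ℕ) : GridEdge m → ℕ × ℕ
  | .inl e => (e.1 + 1, e.2)
  | .inr e => (e.1, e.2 + 1)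

/-- Identify all boundary corners of the grid. -/
def gridCorner (m : ℕ) (c : ℕ × ℕ) : ℕ × ℕ :=
  if 1 ≤ c.1 ∧ c.1 ≤ m ∧ 1 ≤ c.2 ∧ c.2 ≤ m then c else (0, 0)

/-- The first dual end of a grid edge. -/
def gridFst' (m : ℕ) : GridEdge m → ℕ × ℕ
  | .inl e => gridCorner m (e.1 + 1, e.2)
  | .inr e => gridCorner m (e.1, e.2 + 1)

/-- The second dual end of a grid edge. -/
def gridSnd' (m : ℕ) : GridEdge m → ℕ × ℕ
  | .inl e => gridCorner m (e.1 + 1, e.2 + 1)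
  | .inr e => gridCorner m (e.1 + 1, e.2 + 1)

theorem sum_mul_add_succ (m : ℕ) (f v : ℕ → ZMod 2) (h0 : v 0 = 0) (h1 : v (m + 1) = 0) :
    ∑ j ∈ Finset.range (m + 1), f j * (v j + v (j + 1)) =
      ∑ j ∈ Finset.range m, v (j + 1) * (f j + f (j + 1)) := by
  have h2 : ∑ j ∈ Finset.range (m + 1), f j * v j =
      ∑ j ∈ Finset.range m, f (j + 1) * v (j + 1) := by
    rw [Finset.sum_range_succ', h0]; simp
  have h3 : ∑ j ∈ Finset.range (m + 1), f j * v (j + 1) =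
      ∑ j ∈ Finset.range m, f j * v (j + 1) := by
    rw [Finset.sum_range_succ, h1]; simp
  simp only [mul_add, Finset.sum_add_distrib, h2, h3]
  rw [add_comm]
  congr 1 <;> exact Finset.sum_congr rfl fun j _ => mul_comm _ _

theorem grid_sum_by_parts (m : ℕ) (sh sv W : ℕ → ℕ → ZMod 2)
    (h1 : ∀ i, W i 0 = 0) (h2 : ∀ i, W i (m + 1) = 0) (h3 : ∀ j, W 0 j = 0)
    (h4 : ∀ j, W (m + 1) j = 0) :
    (∑ i ∈ Finset.range m, ∑ j ∈ Finset.range (m + 1),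
        sh i j * (W (i + 1) j + W (i + 1) (j + 1))) +
      ∑ i ∈ Finset.range (m + 1), ∑ j ∈ Finset.range m,
        sv i j * (W i (j + 1) + W (i + 1) (j + 1)) =
    ∑ i ∈ Finset.range m, ∑ j ∈ Finset.range m,
      W (i + 1) (j + 1) * (sh i j + sh i (j + 1) + sv i j + sv (i + 1) j) := by
  have e1 : ∀ i, _ := fun i => sum_mul_add_succ m (sh i) (W (i + 1)) (h1 _) (h2 _)
  have e2 : ∀ j, _ := fun j =>
    sum_mul_add_succ m (fun i => sv i j) (fun i => W i (j + 1)) (h3 _) (h4 _)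
  rw [Finset.sum_comm (s := Finset.range (m + 1))]
  simp only [e1, e2]
  rw [Finset.sum_comm (s := Finset.range m) (t := Finset.range m)
    (f := fun j i => W (i + 1) (j + 1) * (sv i j + sv (i + 1) j)), ← Finset.sum_add_distrib]
  refine Finset.sum_congr rfl fun i _ => ?_
  rw [← Finset.sum_add_distrib]
  exact Finset.sum_congr rfl fun j _ => by ring

/-- The planar dual of the grid. -/
theorem isDual_grid (m : ℕ) : IsDual (gridFst m) (gridSnd m) (gridFst' m) (gridSnd' m) := by
  intro s
  let sh : ℕ → ℕ → ZMod 2 := fun i j =>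
    if h : i < m ∧ j < m + 1 then s (.inl (⟨i, h.1⟩, ⟨j, h.2⟩)) else 0
  let sv : ℕ → ℕ → ZMod 2 := fun i j =>
    if h : i < m + 1 ∧ j < m then s (.inr (⟨i, h.1⟩, ⟨j, h.2⟩)) else 0
  have hsh : ∀ (i : Fin m) (j : Fin (m + 1)), s (.inl (i, j)) = sh i j := fun i j =>
    (dif_pos ⟨i.2, j.2⟩ : sh i j = _).symm
  have hsv : ∀ (i : Fin (m + 1)) (j : Fin m), s (.inr (i, j)) = sv i j := fun i j =>
    (dif_pos ⟨i.2, j.2⟩ : sv i j = _).symm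
  have key : ∀ U : ℕ × ℕ → ZMod 2,
      ∑ e, s e * (U (gridFst' m e) + U (gridSnd' m e)) =
      ∑ i ∈ Finset.range m, ∑ j ∈ Finset.range m,
        (U (gridCorner m (i + 1, j + 1)) + U (0, 0)) *
          (sh i j + sh i (j + 1) + sv i j + sv (i + 1) j) := by
    intro U
    have := grid_sum_by_parts m sh sv (fun a b => U (gridCorner m (a, b)) + U (0, 0))
      (fun i => by simp [gridCorner, ZMod.two_self_add])
      (fun i => by simp [gridCorner, ZMod.two_self_add])
      (fun i => by simp [gridCorner, ZMod.two_self_add])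
      (fun i => by simp [gridCorner, ZMod.two_self_add])
    rw [← this, Fintype.sum_sum_type, Fintype.sum_prod_type, Fintype.sum_prod_type]
    simp only [Finset.sum_range]
    have hc : ∀ a b : ZMod 2, a + U (0, 0) + (b + U (0, 0)) = a + b := fun a b => by
      linear_combination ZMod.two_self_add (U (0, 0))
    simp only [hc, hsh, hsv, gridFst', gridSnd']
  constructor
  · intro hs
    have hrel : ∀ i < m, ∀ j < m, sh i j + sh i (j + 1) + sv i j + sv (i + 1) j = 0 := by
      intro i hi j hj
      obtain ⟨D, hD⟩ : ∃ D : ℕ × ℕ → ZMod 2, D = fun c => if c = (i + 1, j + 1) then 1 else 0 :=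
        ⟨_, rfl⟩
      have h1 := hs D
      rw [key, Finset.sum_eq_single_of_mem i (Finset.mem_range.mpr hi),
        Finset.sum_eq_single_of_mem j (Finset.mem_range.mpr hj)] at h1
      · have : gridCorner m (i + 1, j + 1) = (i + 1, j + 1) := if_pos (by simp; omega)
        simpa [this, hD] using h1
      · intro l hl hne
        have : gridCorner m (i + 1, l + 1) = (i + 1, l + 1) :=
          if_pos (by simp at hl ⊢; omega)
        simp [this, hne, hD]
      · intro k hk hne
        refine Finset.sum_eq_zero fun l hl => ?_
        have : gridCorner m (k + 1, l + 1) = (k + 1, l + 1) :=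
          if_pos (by simp at hl hk ⊢; omega)
        simp [this, hne, hD]
    refine ⟨fun c => ∑ k ∈ Finset.range c.1, sh k 0 + ∑ l ∈ Finset.range c.2, sv c.1 l, ?_⟩
    rintro (⟨i, j⟩ | ⟨i, j⟩)
    · rw [hsh]
      have h2 : ∀ j : ℕ, j ≤ m → sh i j =
          sh i 0 + ∑ l ∈ Finset.range j, (sv i l + sv (i + 1) l) := by
        intro j
        induction j with
        | zero => simp
        | succ j ih =>
          intro hj
          rw [Finset.sum_range_succ, ← add_assoc, ← ih (by omega)]
          linear_combination hrel i i.2 j (by omega) - ZMod.two_self_add (sh i j) -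
            ZMod.two_self_add (sv i j) - ZMod.two_self_add (sv (i + 1) j)
      rw [h2 j (by omega)]
      simp only [gridFst, gridSnd, Finset.sum_range_succ, Finset.sum_add_distrib]
      linear_combination - ZMod.two_self_add (∑ x ∈ Finset.range ↑i, sh x 0)
    · rw [hsv]
      simp only [gridFst, gridSnd, Finset.sum_range_succ]
      linear_combination - ZMod.two_self_add (∑ x ∈ Finset.range ↑i, sh x 0) -
        ZMod.two_self_add (∑ x ∈ Finset.range ↑j, sv i x)
  · rintro ⟨A, hA⟩ U
    rw [key]
    refine Finset.sum_eq_zero fun i hi => Finset.sum_eq_zero fun j hj => ?_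
    have hi := Finset.mem_range.mp hi
    have hj := Finset.mem_range.mp hj
    have e1 := hsh ⟨i, hi⟩ ⟨j, by omega⟩
    have e2 := hsh ⟨i, hi⟩ ⟨j + 1, by omega⟩
    have e3 := hsv ⟨i, by omega⟩ ⟨j, hj⟩
    have e4 := hsv ⟨i + 1, by omega⟩ ⟨j, hj⟩
    rw [hA] at e1 e2 e3 e4
    simp only [gridFst, gridSnd] at e1 e2 e3 e4
    rw [← e1, ← e2, ← e3, ← e4]
    linear_combination (U (gridCorner m (i + 1, j + 1)) + U (0, 0)) *
      (ZMod.two_self_add (A (i, j)) + ZMod.two_self_add (A (i + 1, j)) +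
        ZMod.two_self_add (A (i, j + 1)) + ZMod.two_self_add (A (i + 1, j + 1)))

end Grid

section Cells
variable {V ε : Type}

/-- `c'` is the right or upper neighbour of the cell `c`. -/
def CellAdj (c c' : ℤ × ℤ) : Prop := c' = (c.1 + 1, c.2) ∨ c' = (c.1, c.2 + 1)

/-- `U` is constant on adjacent cells of `S`. -/
def CellConst (S : Set (ℤ × ℤ)) (U : ℤ × ℤ → ZMod 2) : Prop :=
  ∀ c ∈ S, ∀ c' ∈ S, CellAdj c c' → U c = U c'

theorem CellConst.mono {S T : Set (ℤ × ℤ)} {U : ℤ × ℤ → ZMod 2} (h : CellConst T U) (hST : S ⊆ T) :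
    CellConst S U := fun c hc d hd => h c (hST hc) d (hST hd)

/-- Adjacent cells of a box are joined by an edge of the finite grid. -/
theorem CellAdj.exists_gridEdge {c c' : ℤ × ℤ} (h : CellAdj c c') (L : ℕ)
    (hc : |c.1| ≤ L ∧ |c.2| ≤ L) (hc' : |c'.1| ≤ L ∧ |c'.2| ≤ L) :
    ∃ z : GridEdge (2 * L), (((gridFst _ z).1 : ℤ) - L, ((gridFst _ z).2 : ℤ) - L) = c ∧
      (((gridSnd _ z).1 : ℤ) - L, ((gridSnd _ z).2 : ℤ) - L) = c' := by
  obtain ⟨x, y⟩ := c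
  simp only [abs_le] at hc hc'
  rcases h with rfl | rfl
  · simp only at hc hc'
    refine ⟨.inl (⟨(x + L).toNat, by omega⟩, ⟨(y + L).toNat, by omega⟩), ?_, ?_⟩ <;>
    · simp only [gridFst, gridSnd, Prod.mk.injEq]
      omega
  · simp only at hc hc'
    refine ⟨.inr (⟨(x + L).toNat, by omega⟩, ⟨(y + L).toNat, by omega⟩), ?_, ?_⟩ <;>
    · simp only [gridFst, gridSnd, Prod.mk.injEq]
      omega

theorem cellAdj_gridEdge (L : ℕ) (z : GridEdge (2 * L)) :
    CellAdj (((gridFst _ z).1 : ℤ) - L, ((gridFst _ z).2 : ℤ) - L)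
      (((gridSnd _ z).1 : ℤ) - L, ((gridSnd _ z).2 : ℤ) - L) := by
  rcases z with z | z
  · left; ext <;> simp only [gridFst, gridSnd] ; push_cast; ring
  · right; ext <;> simp only [gridFst, gridSnd] ; push_cast; ring

/-- A graph drawn by blocks of cells for the vertices and strips of cells for the edges
has an abstract dual. -/
theorem exists_isDual_of_cells [Fintype ε] (p q : ε → V) (hpq : ∀ e, p e ≠ q e)
    (block : V → Set (ℤ × ℤ)) (N : ε → Set (ℤ × ℤ)) (a b : ε → ℤ × ℤ) (L : ℕ)
    (hconn : ∀ v U, CellConst (block v) U → ∀ c ∈ block v, ∀ c' ∈ block v, U c = U c')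
    (hdisj : ∀ v w, ∀ c ∈ block v, c ∈ block w → v = w)
    (hsep : ∀ v w, ∀ c ∈ block v, ∀ c' ∈ block w, CellAdj c c' → v = w)
    (hinc : ∀ e w, ∀ c ∈ N e, c ∈ block w → w = p e ∨ w = q e)
    (hmeet : ∀ e f, e ≠ f → ∀ c ∈ N e, c ∈ N f →
      ∃ u, (u = p e ∨ u = q e) ∧ (u = p f ∨ u = q f) ∧ c ∈ block u)
    (ha : ∀ e, a e ∈ block (p e)) (hb : ∀ e, b e ∈ block (q e)) (hbN : ∀ e, b e ∈ N e)
    (hchain : ∀ e U, CellConst (N e) U → U (a e) = U (b e))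
    (hL : ∀ v, ∀ c ∈ block v, |c.1| ≤ L ∧ |c.2| ≤ L)
    (hLN : ∀ e, ∀ c ∈ N e, |c.1| ≤ L ∧ |c.2| ≤ L) :
    ∃ (F : Type) (p' q' : ε → F), IsDual p q p' q' := by
  let φ : ℕ × ℕ → ℤ × ℤ := fun c => (c.1 - L, c.2 - L)
  let X : ε → Set (ℤ × ℤ) := fun e => {c | c ∈ N e \ block (p e) ∧
    ∀ U, CellConst (N e \ block (p e)) U → U c = U (b e)}
  have hstep : ∀ e, ∀ c ∈ X e, ∀ c' ∈ N e \ block (p e), CellAdj c c' ∨ CellAdj c' c →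
      c' ∈ X e := by
    intro e c hc c' hc' hadj
    refine ⟨hc', fun U hU => ?_⟩
    rw [← hc.2 U hU]
    rcases hadj with h | h
    · exact (hU c hc.1 c' hc' h).symm
    · exact hU c' hc' c hc.1 h
  have hbX : ∀ e, b e ∈ X e := fun e =>
    ⟨⟨hbN e, fun h => hpq e (hdisj _ _ _ h (hb e))⟩, fun U _ => rfl⟩
  have hg : ∀ e, ∃ z : GridEdge (2 * L), ∃ c ∈ N e ∩ block (p e), ∃ c' ∈ X e,
      (φ (gridFst _ z) = c ∧ φ (gridSnd _ z) = c') ∨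
      (φ (gridFst _ z) = c' ∧ φ (gridSnd _ z) = c) := by
    intro e
    by_contra hcon
    have hU := hchain e (fun c => if c ∈ X e then 1 else 0) (by
      intro c hc c' hc' hadj
      have hedge := hadj.exists_gridEdge L (hLN e c hc) (hLN e c' hc')
      have h1 : c ∈ X e ↔ c' ∈ X e := by
        constructor
        · intro h
          by_contra h'
          refine hcon ?_
          obtain ⟨z, hz⟩ := hedge
          refine ⟨z, c', ⟨hc', ?_⟩, c, h, Or.inr hz⟩
          by_contra h2
          exact h' (hstep e c h c' ⟨hc', h2⟩ (Or.inl hadj))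
        · intro h
          by_contra h'
          refine hcon ?_
          obtain ⟨z, hz⟩ := hedge
          refine ⟨z, c, ⟨hc, ?_⟩, c', h, Or.inl hz⟩
          by_contra h2
          exact h' (hstep e c' h c ⟨hc, h2⟩ (Or.inr hadj))
      simp only [h1])
    have h2 : a e ∉ X e := fun h => h.1.2 (ha e)
    simp [h2, hbX e] at hU
  choose g c hc c' hc' hgc using hg
  let B : V → Set (ℤ × ℤ) := fun v => {x | x ∈ block v ∨ ∃ e, q e = v ∧ x ∈ X e}
  have hBL : ∀ v, ∀ x ∈ B v, |x.1| ≤ L ∧ |x.2| ≤ L := by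
    rintro v x (h | ⟨e, -, h⟩)
    · exact hL v x h
    · exact hLN e x h.1.1
  have hblockX : ∀ v e x, x ∈ block v → x ∈ X e → v = q e := by
    intro v e x hx hxe
    rcases hinc e v x hxe.1.1 hx with rfl | h
    · exact absurd hx hxe.1.2
    · exact h
  have hBdisj : ∀ v w x, x ∈ B v → x ∈ B w → v = w := by
    rintro v w x (h | ⟨e, rfl, h⟩) (h' | ⟨f, rfl, h'⟩)
    · exact hdisj v w x h h'
    · exact hblockX v f x h h'
    · exact (hblockX w e x h' h).symm
    · by_cases hef : e = f
      · rw [hef]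
      · obtain ⟨u, -, -, hu⟩ := hmeet e f hef x h.1.1 h'.1.1
        rw [← hblockX u e x hu h, ← hblockX u f x hu h']
  have hcB : ∀ e, c e ∈ B (p e) := fun e => Or.inl (hc e).2
  have hcB' : ∀ e, c' e ∈ B (q e) := fun e => Or.inr ⟨e, rfl, hc' e⟩
  let Z : Set (GridEdge (2 * L)) :=
    {z | ∃ v, φ (gridFst _ z) ∈ B v ∧ φ (gridSnd _ z) ∈ B v}
  refine (isDual_grid (2 * L)).exists_minor p q g ?_ Z (fun v => {x | φ x ∈ B v}) ?_ ?_ ?_ ?_ ?_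
  · intro e f hef
    by_contra hne
    have hce : c e ∈ N f ∧ c' e ∈ N f := by
      rcases hgc e with ⟨h1, h2⟩ | ⟨h1, h2⟩ <;> rcases hgc f with ⟨h3, h4⟩ | ⟨h3, h4⟩ <;>
        rw [hef] at h1 h2 <;> rw [← h1, ← h2, h3, h4] <;>
        first | exact ⟨(hc f).1, (hc' f).1.1⟩ | exact ⟨(hc' f).1.1, (hc f).1⟩
    obtain ⟨u, hu, -, hu'⟩ := hmeet e f hne _ (hc' e).1.1 hce.2
    have hadj := cellAdj_gridEdge L (g e)
    have : p e = u := by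
      rcases hgc e with ⟨h1, h2⟩ | ⟨h1, h2⟩
      · exact hsep _ _ _ (hc e).2 _ hu' (h1 ▸ h2 ▸ hadj)
      · exact (hsep _ _ _ hu' _ (hc e).2 (h1 ▸ h2 ▸ hadj)).symm
    exact (hc' e).1.2 (this ▸ hu')
  · rintro e ⟨v, h1, h2⟩
    rcases hgc e with ⟨h3, h4⟩ | ⟨h3, h4⟩ <;> rw [h3] at h1 <;> rw [h4] at h2
    · exact hpq e ((hBdisj _ _ _ (hcB e) h1).trans (hBdisj _ _ _ h2 (hcB' e)))
    · exact hpq e ((hBdisj _ _ _ (hcB e) h2).trans (hBdisj _ _ _ h1 (hcB' e)))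
  · intro e
    rcases hgc e with ⟨h3, h4⟩ | ⟨h3, h4⟩
    · exact Or.inl ⟨show φ _ ∈ _ from h3 ▸ hcB e, show φ _ ∈ _ from h4 ▸ hcB' e⟩
    · exact Or.inr ⟨show φ _ ∈ _ from h3 ▸ hcB' e, show φ _ ∈ _ from h4 ▸ hcB e⟩
  · exact fun v w x h h' => hBdisj v w _ h h'
  · intro v U hU
    let W : ℤ × ℤ → ZMod 2 := fun x => U ((x.1 + L).toNat, (x.2 + L).toNat)
    have hW : ∀ x, W (φ x) = U x := by
      intro x
      have : (((φ x).1 + L).toNat, ((φ x).2 + L).toNat) = x := by simp [φ]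
      simp only [W, this]
    have hWB : CellConst (B v) W := by
      intro x hx y hy hadj
      obtain ⟨z, rfl, rfl⟩ := hadj.exists_gridEdge L (hBL v x hx) (hBL v y hy)
      have := hU z ⟨v, hx, hy⟩
      rw [← hW, ← hW] at this
      exact this
    have hroot : ∀ x ∈ B v, ∀ y ∈ block v, W x = W y := by
      rintro x (hx | ⟨e, rfl, hx⟩) y hy
      · exact hconn v W (hWB.mono fun _ h => Or.inl h) x hx y hy
      · have h0 := hx.2 (fun y => if y ∈ X e then W y + W (b e) else 0) (by
          intro x hx y hy hadj
          by_cases h1 : x ∈ X e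
          · have h2 := hstep e x h1 y hy (Or.inl hadj)
            simp only [h1, h2, if_true]
            rw [hWB x (Or.inr ⟨e, rfl, h1⟩) y (Or.inr ⟨e, rfl, h2⟩) hadj]
          · have h2 : y ∉ X e := fun h2 => h1 (hstep e y h2 x hx (Or.inr hadj))
            simp only [h1, h2, if_false])
        simp only [hx, hbX e, if_true, ZMod.two_self_add] at h0
        rw [ZMod.two_eq_of_add_eq_zero h0]
        exact hconn (q e) W (hWB.mono fun _ h => Or.inl h) _ (hb e) y hy
    intro x hx y hy
    have hx' : φ x ∈ B v := hx
    obtain ⟨z, hz⟩ : ∃ z, z ∈ block v := by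
      rcases hx' with h | ⟨e, rfl, h⟩
      · exact ⟨_, h⟩
      · exact ⟨_, hb e⟩
    rw [← hW x, ← hW y, hroot _ hx z hz, hroot _ hy z hz]
  · rintro z ⟨v, h1, h2⟩
    exact ⟨v, h1, h2⟩

end Cells

section Drawing
variable {V ε : Type}

theorem eq_of_eq_add_one {I : Set ℤ} (hI : I.OrdConnected) {α : Type} (f : ℤ → α)
    (h : ∀ n ∈ I, n + 1 ∈ I → f n = f (n + 1)) {m n : ℤ} (hm : m ∈ I) (hn : n ∈ I) :
    f m = f n := by
  wlog hmn : m ≤ n generalizing m n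
  · exact (this hn hm (le_of_not_ge hmn)).symm
  induction n, hmn using Int.leInduction with
  | base => rfl
  | succ n hmn ih =>
    have : n ∈ I := hI.out hm hn ⟨hmn, by omega⟩
    rw [ih this, h n this hn]

theorem CellConst.eq_of_prod {I J : Set ℤ} (hI : I.OrdConnected) (hJ : J.OrdConnected)
    {U : ℤ × ℤ → ZMod 2} (hU : CellConst (I ×ˢ J) U) {c c' : ℤ × ℤ} (hc : c ∈ I ×ˢ J)
    (hc' : c' ∈ I ×ˢ J) : U c = U c' := by
  obtain ⟨a, b⟩ := c
  obtain ⟨a', b'⟩ := c'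
  obtain ⟨h1, h2⟩ := hc
  obtain ⟨h3, h4⟩ := hc'
  simp only at h1 h2 h3 h4
  have e1 : U (a, b) = U (a', b) := eq_of_eq_add_one hI (fun n => U (n, b))
    (fun n hn hn' => hU (n, b) ⟨hn, h2⟩ (n + 1, b) ⟨hn', h2⟩ (Or.inl rfl)) h1 h3
  have e2 : U (a', b) = U (a', b') := eq_of_eq_add_one hJ (fun n => U (a', n))
    (fun n hn hn' => hU (a', n) ⟨h3, hn⟩ (a', n + 1) ⟨h3, hn'⟩ (Or.inr rfl)) h2 h4
  exact e1.trans e2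

/-- The corner point of a cell of mesh `δ`. -/
def cellPt (δ : ℝ) (c : ℤ × ℤ) : ℝ × ℝ := (δ * c.1, δ * c.2)

/-- The cell of mesh `δ` containing a point. -/
def cellOf (δ : ℝ) (x : ℝ × ℝ) : ℤ × ℤ := (⌊x.1 / δ⌋, ⌊x.2 / δ⌋)

theorem dist_cellPt_le {δ r : ℝ} {c : ℤ × ℤ} {x : ℝ × ℝ} :
    dist (cellPt δ c) x ≤ r ↔ |δ * c.1 - x.1| ≤ r ∧ |δ * c.2 - x.2| ≤ r := by
  rw [Prod.dist_eq, max_le_iff, Real.dist_eq, Real.dist_eq]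
  rfl

theorem abs_mul_floor_sub_le {δ : ℝ} (hδ : 0 < δ) (x : ℝ) : |δ * ⌊x / δ⌋ - x| ≤ δ := by
  have h1 := Int.floor_le (x / δ)
  have h2 := Int.lt_floor_add_one (x / δ)
  rw [le_div_iff₀ hδ] at h1
  rw [div_lt_iff₀ hδ] at h2
  rw [abs_le]
  constructor <;> nlinarith

theorem dist_cellPt_cellOf_le {δ : ℝ} (hδ : 0 < δ) (x : ℝ × ℝ) :
    dist (cellPt δ (cellOf δ x)) x ≤ δ :=
  dist_cellPt_le.mpr ⟨abs_mul_floor_sub_le hδ _, abs_mul_floor_sub_le hδ _⟩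

theorem dist_cellPt_of_cellAdj {δ : ℝ} (hδ : 0 < δ) {c c' : ℤ × ℤ} (h : CellAdj c c') :
    dist (cellPt δ c) (cellPt δ c') ≤ δ := by
  rw [dist_cellPt_le]
  rcases h with rfl | rfl <;> simp [cellPt, mul_add, abs_of_pos hδ, hδ.le]

theorem abs_floor_sub_floor_le {δ : ℝ} (hδ : 0 < δ) {x y : ℝ} (h : |x - y| < δ) :
    ⌊x / δ⌋ ≤ ⌊y / δ⌋ + 1 ∧ ⌊y / δ⌋ ≤ ⌊x / δ⌋ + 1 := by
  have hd : |x / δ - y / δ| < 1 := by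
    rw [← sub_div, abs_div, abs_of_pos hδ, div_lt_one hδ]; exact h
  rw [abs_lt] at hd
  have h1 := Int.floor_le (x / δ)
  have h2 := Int.lt_floor_add_one (x / δ)
  have h3 := Int.floor_le (y / δ)
  have h4 := Int.lt_floor_add_one (y / δ)
  constructor
  · have : (⌊x / δ⌋ : ℝ) < ⌊y / δ⌋ + 2 := by linarith
    have : ⌊x / δ⌋ < ⌊y / δ⌋ + 2 := by exact_mod_cast this
    omega
  · have : (⌊y / δ⌋ : ℝ) < ⌊x / δ⌋ + 2 := by linarith
    have : ⌊y / δ⌋ < ⌊x / δ⌋ + 2 := by exact_mod_cast this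
    omega

/-- The strip of cells near the set `K`. -/
def strip (δ : ℝ) (K : Set (ℝ × ℝ)) : Set (ℤ × ℤ) := {c | ∃ y ∈ K, dist (cellPt δ c) y ≤ 2 * δ}

theorem CellConst.eq_of_dist_lt {δ : ℝ} (hδ : 0 < δ) {K : Set (ℝ × ℝ)} {U : ℤ × ℤ → ZMod 2}
    (hU : CellConst (strip δ K) U) {x y : ℝ × ℝ} (hx : x ∈ K) (hy : y ∈ K) (h : dist x y < δ) :
    U (cellOf δ x) = U (cellOf δ y) := by
  rw [Prod.dist_eq, max_lt_iff, Real.dist_eq, Real.dist_eq] at h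
  have f1 := abs_floor_sub_floor_le hδ h.1
  have f2 := abs_floor_sub_floor_le hδ h.2
  have b1 := abs_mul_floor_sub_le hδ x.1
  have b2 := abs_mul_floor_sub_le hδ x.2
  have b3 := abs_mul_floor_sub_le hδ y.1
  have b4 := abs_mul_floor_sub_le hδ y.2
  have m1 : cellOf δ x ∈ strip δ K := ⟨x, hx, (dist_cellPt_cellOf_le hδ x).trans (by linarith)⟩
  have m2 : cellOf δ y ∈ strip δ K := ⟨y, hy, (dist_cellPt_cellOf_le hδ y).trans (by linarith)⟩
  have m3 : (⌊y.1 / δ⌋, ⌊x.2 / δ⌋) ∈ strip δ K := by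
    refine ⟨x, hx, dist_cellPt_le.mpr ⟨?_, by simpa using b2.trans (by linarith)⟩⟩
    have := abs_sub_le (δ * (⌊y.1 / δ⌋ : ℝ)) y.1 x.1
    rw [abs_sub_comm y.1] at this
    simp only
    linarith
  have e1 : U (cellOf δ x) = U (⌊y.1 / δ⌋, ⌊x.2 / δ⌋) := by
    rcases lt_trichotomy ⌊x.1 / δ⌋ ⌊y.1 / δ⌋ with hlt | heq | hlt
    · exact hU _ m1 _ m3 (Or.inl (Prod.ext (by simp only [cellOf]; omega) rfl))
    · rw [← heq]; rfl
    · exact (hU _ m3 _ m1 (Or.inl (Prod.ext (by simp only [cellOf]; omega) rfl))).symm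
  rw [e1]
  rcases lt_trichotomy ⌊x.2 / δ⌋ ⌊y.2 / δ⌋ with hlt | heq | hlt
  · exact hU _ m3 _ m2 (Or.inr (Prod.ext rfl (by simp only [cellOf]; omega)))
  · rw [heq]; rfl
  · exact (hU _ m2 _ m3 (Or.inr (Prod.ext rfl (by simp only [cellOf]; omega)))).symm

theorem CellConst.eq_of_arc {δ : ℝ} (hδ : 0 < δ) {arc : ℝ → ℝ × ℝ}
    (hc : ContinuousOn arc (Set.Icc 0 1)) {U : ℤ × ℤ → ZMod 2}
    (hU : CellConst (strip δ (arc '' Set.Icc 0 1)) U) :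
    U (cellOf δ (arc 0)) = U (cellOf δ (arc 1)) := by
  have hf : ContinuousOn (fun t => (U (cellOf δ (arc t))).val) (Set.Icc 0 1) := by
    intro t ht
    have h0 : ContinuousWithinAt (fun _ : ℝ => (U (cellOf δ (arc t))).val) (Set.Icc 0 1) t :=
      continuousWithinAt_const
    refine h0.congr_of_eventuallyEq ?_ rfl
    have h1 := (hc t ht).eventually (Metric.ball_mem_nhds _ hδ)
    filter_upwards [h1, self_mem_nhdsWithin] with s hs hs'
    rw [hU.eq_of_dist_lt hδ ⟨s, hs', rfl⟩ ⟨t, ht, rfl⟩ hs]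
  exact ZMod.val_injective 2 (isPreconnected_Icc.constant hf (by simp) (by simp))

/-- Points close to two compact sets are close to their intersection. -/
theorem eventually_near_inter {E : Type} [PseudoMetricSpace E] {K L O : Set E} (hK : IsCompact K)
    (hL : IsClosed L) (hO : IsOpen O) (hKL : K ∩ L ⊆ O) :
    ∀ᶠ r in nhdsWithin (0 : ℝ) (Set.Ioi 0), ∀ x, ∀ y ∈ K, ∀ z ∈ L,
      dist x y ≤ r → dist x z ≤ r → y ∈ O := by
  have hd : Disjoint (K \ O) L := Set.disjoint_left.mpr fun x hx hx' => hx.2 (hKL ⟨hx.1, hx'⟩)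
  obtain ⟨r, hr, hdr⟩ := hd.exists_thickenings (hK.diff hO) hL
  filter_upwards [Ioo_mem_nhdsGT hr] with r' hr' x y hy z hz hxy hxz
  by_contra hyO
  have h1 : x ∈ Metric.thickening r (K \ O) :=
    Metric.mem_thickening_iff.mpr ⟨y, ⟨hy, hyO⟩, hxy.trans_lt hr'.2⟩
  have h2 : x ∈ Metric.thickening r L := Metric.mem_thickening_iff.mpr ⟨z, hz, hxz.trans_lt hr'.2⟩
  exact Set.disjoint_left.mp hdr h1 h2

/-- A loopless plane drawing yields an abstract dual. -/
theorem exists_isDual_of_drawing [Fintype V] [Fintype ε] (p q : ε → V) (hpq : ∀ e, p e ≠ q e)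
    (pos : V → ℝ × ℝ) (arc : ε → ℝ → ℝ × ℝ) (hpos : Function.Injective pos)
    (hcont : ∀ e, ContinuousOn (arc e) (Set.Icc 0 1))
    (h0 : ∀ e, arc e 0 = pos (p e)) (h1 : ∀ e, arc e 1 = pos (q e))
    (hdisj : ∀ e f, e ≠ f → ∀ s ∈ Set.Ioo (0 : ℝ) 1, ∀ t ∈ Set.Icc (0 : ℝ) 1, arc e s ≠ arc f t)
    (hvert : ∀ e, ∀ s ∈ Set.Ioo (0 : ℝ) 1, ∀ w, arc e s ≠ pos w) :
    ∃ (F : Type) (p' q' : ε → F), IsDual p q p' q' := by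
  let K : ε → Set (ℝ × ℝ) := fun e => arc e '' Set.Icc 0 1
  have hKc : ∀ e, IsCompact (K e) := fun e => isCompact_Icc.image_of_continuousOn (hcont e)
  have hends : ∀ t ∈ Set.Icc (0 : ℝ) 1, t ∈ Set.Ioo (0 : ℝ) 1 ∨ t = 0 ∨ t = 1 := by
    intro t ht
    rcases ht.1.eq_or_lt with h | h
    · exact Or.inr (Or.inl h.symm)
    · rcases ht.2.eq_or_lt with h' | h'
      · exact Or.inr (Or.inr h')
      · exact Or.inl ⟨h, h'⟩
  have hKpos : ∀ e w, pos w ∈ K e → w = p e ∨ w = q e := by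
    rintro e w ⟨t, ht, htw⟩
    rcases hends t ht with h | rfl | rfl
    · exact absurd htw (hvert e t h w)
    · exact Or.inl (hpos (htw.symm.trans (h0 e)))
    · exact Or.inr (hpos (htw.symm.trans (h1 e)))
  have hKK : ∀ e f, e ≠ f → ∀ x ∈ K e, x ∈ K f →
      ∃ u, (u = p e ∨ u = q e) ∧ (u = p f ∨ u = q f) ∧ x = pos u := by
    rintro e f hef x ⟨t, ht, rfl⟩ hx
    rcases hends t ht with h | rfl | rfl
    · obtain ⟨s, hs, hst⟩ := hx
      exact absurd hst.symm (hdisj e f hef t h s hs)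
    · rw [h0] at hx ⊢
      exact ⟨p e, Or.inl rfl, hKpos f _ hx, rfl⟩
    · rw [h1] at hx ⊢
      exact ⟨q e, Or.inr rfl, hKpos f _ hx, rfl⟩
  obtain ⟨ρ, ⟨hρ1, hρ2⟩, hρ⟩ : ∃ ρ : ℝ, ((∀ v w, v ≠ w → 3 * ρ < dist (pos v) (pos w)) ∧
      ∀ e w, ¬(w = p e ∨ w = q e) → ∀ x, ∀ y ∈ K e, ∀ z ∈ ({pos w} : Set (ℝ × ℝ)),
        dist x y ≤ ρ → dist x z ≤ ρ → y ∈ (∅ : Set (ℝ × ℝ))) ∧ 0 < ρ := by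
    refine (Filter.Eventually.and (Filter.Eventually.and ?_ ?_)
      (self_mem_nhdsWithin : Set.Ioi (0 : ℝ) ∈ nhdsWithin 0 (Set.Ioi 0))).exists
    · rw [Filter.eventually_all]; intro v
      rw [Filter.eventually_all]; intro w
      by_cases hvw : v = w
      · simp [hvw]
      · have hd : 0 < dist (pos v) (pos w) := dist_pos.mpr fun h => hvw (hpos h)
        filter_upwards [Ioo_mem_nhdsGT (show 0 < dist (pos v) (pos w) / 3 by linarith)] with r hr _
        linarith [hr.2]
    · rw [Filter.eventually_all]; intro e
      rw [Filter.eventually_all]; intro w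
      by_cases hw : w = p e ∨ w = q e
      · simp [hw]
      · filter_upwards [eventually_near_inter (hKc e) (isClosed_singleton (x := pos w))
          isOpen_empty (fun x hx => hw (hKpos e w (hx.2 ▸ hx.1)))] with r hr _ using hr
  obtain ⟨r, ⟨hr1, hr2⟩, hr⟩ : ∃ r : ℝ, ((∀ e f, e ≠ f → ∀ x, ∀ y ∈ K e, ∀ z ∈ K f,
      dist x y ≤ r → dist x z ≤ r → y ∈ {x | ∃ u, ((u = p e ∨ u = q e) ∧ (u = p f ∨ u = q f)) ∧
        x ∈ Metric.ball (pos u) (ρ / 2)}) ∧ r ≤ ρ / 2) ∧ 0 < r := by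
    refine (Filter.Eventually.and (Filter.Eventually.and ?_ ?_)
      (self_mem_nhdsWithin : Set.Ioi (0 : ℝ) ∈ nhdsWithin 0 (Set.Ioi 0))).exists
    · rw [Filter.eventually_all]; intro e
      rw [Filter.eventually_all]; intro f
      by_cases hef : e = f
      · simp [hef]
      · have hO : IsOpen {x | ∃ u, ((u = p e ∨ u = q e) ∧ (u = p f ∨ u = q f)) ∧
            x ∈ Metric.ball (pos u) (ρ / 2)} := by
          simp only [Set.ofPred_exists]
          refine isOpen_iUnion fun u => ?_
          by_cases hu : (u = p e ∨ u = q e) ∧ (u = p f ∨ u = q f)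
          · simp only [hu, true_and]
            exact Metric.isOpen_ball
          · simp only [hu, false_and, Set.ofPred_false]
            exact isOpen_empty
        filter_upwards [eventually_near_inter (hKc e) (hKc f).isClosed hO (by
          rintro x ⟨hx, hx'⟩
          obtain ⟨u, hu, hu', rfl⟩ := hKK e f hef x hx hx'
          exact ⟨u, ⟨hu, hu'⟩, Metric.mem_ball_self (by linarith)⟩)] with r hr _ using hr
    · filter_upwards [Ioo_mem_nhdsGT (show 0 < ρ / 2 by linarith)] with r hr using hr.2.le
  obtain ⟨δ, hδr⟩ : ∃ δ, r = 2 * δ := ⟨r / 2, by ring⟩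
  have hδ : 0 < δ := by linarith
  obtain ⟨R, hR⟩ : ∃ R, Set.range pos ∪ ⋃ e, K e ⊆ Metric.closedBall 0 R :=
    ((Set.finite_range pos).isBounded.union
      ((isCompact_iUnion hKc).isBounded)).subset_closedBall 0
  have hbox : ∀ c x, x ∈ Set.range pos ∪ ⋃ e, K e → dist (cellPt δ c) x ≤ ρ →
      |c.1| ≤ ⌈(R + ρ) / δ⌉₊ ∧ |c.2| ≤ ⌈(R + ρ) / δ⌉₊ := by
    intro c x hx hcx
    have h2 : dist (cellPt δ c) 0 ≤ R + ρ := by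
      have := dist_triangle (cellPt δ c) x 0
      have := Metric.mem_closedBall.mp (hR hx)
      linarith
    have h3 : ∀ n : ℤ, |δ * n - 0| ≤ R + ρ → |n| ≤ ⌈(R + ρ) / δ⌉₊ := by
      intro n hn
      rw [sub_zero, abs_mul, abs_of_pos hδ, mul_comm, ← le_div_iff₀ hδ] at hn
      have := hn.trans (Nat.le_ceil _)
      exact_mod_cast this
    rw [dist_cellPt_le] at h2
    exact ⟨h3 _ h2.1, h3 _ h2.2⟩
  refine exists_isDual_of_cells p q hpq (fun v => {c | dist (cellPt δ c) (pos v) ≤ ρ})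
    (fun e => strip δ (K e)) (fun e => cellOf δ (pos (p e))) (fun e => cellOf δ (pos (q e)))
    ⌈(R + ρ) / δ⌉₊ ?_ ?_ ?_ ?_ ?_ ?_ ?_ ?_ ?_ ?_ ?_
  · intro v U hU c hc c' hc'
    have hset : ∀ a : ℝ, Set.OrdConnected {n : ℤ | |δ * n - a| ≤ ρ} := by
      intro a
      refine ⟨fun x hx y hy z hz => ?_⟩
      have h2 : δ * x ≤ δ * z := by
        exact mul_le_mul_of_nonneg_left (by exact_mod_cast hz.1) hδ.le
      have h3 : δ * z ≤ δ * y := by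
        exact mul_le_mul_of_nonneg_left (by exact_mod_cast hz.2) hδ.le
      simp only [Set.mem_ofPred_eq, abs_le] at hx hy ⊢
      constructor <;> linarith [hx.1, hy.2]
    have hprod : {c | dist (cellPt δ c) (pos v) ≤ ρ} =
        {n : ℤ | |δ * n - (pos v).1| ≤ ρ} ×ˢ {n : ℤ | |δ * n - (pos v).2| ≤ ρ} := by
      ext c
      exact dist_cellPt_le
    rw [hprod] at hU hc hc'
    exact hU.eq_of_prod (hset _) (hset _) hc hc'
  · intro v w c hc hc'
    by_contra hvw
    have := hρ1 v w hvw
    have := dist_triangle_left (pos v) (pos w) (cellPt δ c)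
    simp only [Set.mem_ofPred_eq] at hc hc'
    linarith
  · intro v w c hc c' hc' hadj
    by_contra hvw
    have := hρ1 v w hvw
    have := dist_triangle_left (pos v) (pos w) (cellPt δ c)
    have := dist_triangle (cellPt δ c) (cellPt δ c') (pos w)
    have := dist_cellPt_of_cellAdj hδ hadj
    simp only [Set.mem_ofPred_eq] at hc hc'
    linarith
  · rintro e w c ⟨y, hy, hcy⟩ hc
    by_contra hw
    exact hρ2 e w hw _ y hy _ rfl (by linarith) hc
  · rintro e f hef c ⟨y, hy, hcy⟩ ⟨z, hz, hcz⟩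
    obtain ⟨u, hu, hyu⟩ := hr1 e f hef _ y hy z hz (by linarith) (by linarith)
    refine ⟨u, hu.1, hu.2, ?_⟩
    have := dist_triangle (cellPt δ c) y (pos u)
    have := Metric.mem_ball.mp hyu
    simp only [Set.mem_ofPred_eq]
    linarith
  · intro e
    have := dist_cellPt_cellOf_le hδ (pos (p e))
    simp only [Set.mem_ofPred_eq]
    linarith
  · intro e
    have := dist_cellPt_cellOf_le hδ (pos (q e))
    simp only [Set.mem_ofPred_eq]
    linarith
  · intro e
    have := dist_cellPt_cellOf_le hδ (pos (q e))
    exact ⟨pos (q e), ⟨1, by simp, h1 e⟩, by linarith⟩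
  · intro e U hU
    have := hU.eq_of_arc hδ (hcont e)
    rwa [h0, h1] at this
  · exact fun v c hc => hbox c (pos v) (Or.inl ⟨v, rfl⟩) hc
  · rintro e c ⟨y, hy, hcy⟩
    exact hbox c y (Or.inr (Set.mem_iUnion.mpr ⟨e, hy⟩)) (by linarith)

end Drawing

section Sparsity
variable {V F ε ι : Type}

/-- A nonempty even edge set in a simple graph has at least three edges. -/
theorem three_le_card_of_degTwo_eq_zero {a b : ε → ι} {S : Finset ε} (hS : S.Nonempty)
    (hab : ∀ e ∈ S, a e ≠ b e)
    (hinj : ∀ e ∈ S, ∀ f ∈ S, s(a e, b e) = s(a f, b f) → e = f)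
    (h : ∀ j, degTwo a b S j = 0) : 3 ≤ S.card := by
  have hpos := hS.card_pos
  by_contra hlt
  have : S.card = 1 ∨ S.card = 2 := by omega
  rcases this with h1 | h2
  · obtain ⟨e, rfl⟩ := Finset.card_eq_one.mp h1
    have := h (a e)
    simp [degTwo, (hab e (by simp)).symm] at this
  · obtain ⟨e, f, hef, rfl⟩ := Finset.card_eq_two.mp h2
    have h3 := h (a e)
    have h4 := h (b e)
    have h5 := hab e (by simp)
    have h6 := hab f (by simp)
    rw [degTwo, Finset.sum_pair hef] at h3 h4
    simp only [if_true, if_neg h5, if_neg h5.symm] at h3 h4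
    refine hef (hinj e (by simp) f (by simp) ?_)
    rw [Sym2.eq_iff]
    by_cases c1 : a f = a e <;> by_cases c2 : b f = a e <;> by_cases c3 : a f = b e <;>
      by_cases c4 : b f = b e <;> simp_all

/-- Contracting pairwise disjoint connected sets of the dual graph gives a graph with few
parallel classes of edges. -/
theorem IsDual.card_le [Fintype V] [Fintype ε] {p q : ε → V} {p' q' : ε → F}
    (hd : IsDual p q p' q') (J : Finset ι) (K : ι → Set F) (T : Set ε)
    (hK : ∀ i ∈ J, ∀ j ∈ J, ∀ v ∈ K i, v ∈ K j → i = j)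
    (hT : ∀ e ∈ T, ∀ i ∈ J, p' e ∈ K i ↔ q' e ∈ K i)
    (hconn : ∀ i ∈ J, ∀ U : F → ZMod 2, (∀ e ∈ T, U (p' e) = U (q' e)) →
      ∀ x ∈ K i, ∀ y ∈ K i, U x = U y)
    (R : Finset ε) (a b : ε → ι) (ha : ∀ e ∈ R, a e ∈ J ∧ p' e ∈ K (a e))
    (hb : ∀ e ∈ R, b e ∈ J ∧ q' e ∈ K (b e)) (hab : ∀ e ∈ R, a e ≠ b e)
    (hinj : ∀ e ∈ R, ∀ f ∈ R, s(a e, b e) = s(a f, b f) → e = f) :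
    R.card ≤ 3 * J.card := by
  have hRT : ∀ e ∈ R, e ∉ T := fun e he heT =>
    hab e he (hK _ (ha e he).1 _ (hb e he).1 (q' e)
      ((hT e heT _ (ha e he).1).mp (ha e he).2) (hb e he).2)
  let bd : (R → ZMod 2) →ₗ[ZMod 2] (J → ZMod 2) :=
    { toFun := fun y j => ∑ e : R, y e *
        ((if a e = j then 1 else 0) + (if b e = j then 1 else 0))
      map_add' := fun y z => by
        funext j
        simp only [Pi.add_apply, add_mul, Finset.sum_add_distrib]
      map_smul' := fun c y => by
        funext j
        simp only [Pi.smul_apply, smul_eq_mul, RingHom.id_apply, Finset.mul_sum, mul_assoc] }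
  let r : V → V → Prop := fun x y => ∃ e, e ∉ R ∧ e ∉ T ∧ p e = x ∧ q e = y
  let vec : Quot r → R → ZMod 2 := fun w e =>
    (if Quot.mk r (p e) = w then 1 else 0) + (if Quot.mk r (q e) = w then 1 else 0)
  have : Finite (Quot r) := Quot.finite r
  have : Fintype (Quot r) := Fintype.ofFinite _
  let W : Finset (Quot r) := Finset.univ.filter fun w => vec w ≠ 0
  have hspan : LinearMap.ker bd ≤ Submodule.span (ZMod 2) (W.image vec : Finset (R → ZMod 2)) := by
    intro y hy
    have hy : bd y = 0 := hy
    obtain ⟨s', hs', hev⟩ := exists_lift_even p' q' T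
      (fun e => if h : e ∈ R then y ⟨e, h⟩ else 0) (by
        intro U hU
        have hval : ∀ i, ∃ x, i ∈ J → ∀ v ∈ K i, U v = x := by
          intro i
          by_cases hi : i ∈ J
          · rcases (K i).eq_empty_or_nonempty with h | ⟨v, hv⟩
            · exact ⟨0, by simp [h]⟩
            · exact ⟨U v, fun _ v' hv' => hconn i hi U hU v' hv' v hv⟩
          · exact ⟨0, fun h => absurd h hi⟩
        choose u hu using hval
        have h1 : ∑ j : J, u j * bd y j = 0 := by simp [hy]
        rw [← Finset.sum_subset (Finset.subset_univ R), ← Finset.sum_coe_sort R]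
        · rw [← h1]
          simp only [bd, LinearMap.coe_mk, AddHom.coe_mk, Finset.mul_sum]
          rw [Finset.sum_comm]
          refine Finset.sum_congr rfl fun e _ => ?_
          have h2 := ha e e.2
          have h3 := hb e e.2
          rw [dif_pos e.2, hu _ h2.1 _ h2.2, hu _ h3.1 _ h3.2]
          have h4 : ∀ i ∈ J, ∑ j : J, u j * (if i = (j : ι) then (1 : ZMod 2) else 0) = u i := by
            intro i hi
            rw [Finset.sum_eq_single_of_mem ⟨i, hi⟩ (Finset.mem_univ _)]
            · simp
            · intro j _ hj
              rw [if_neg (fun h => hj (Subtype.ext h.symm)), mul_zero]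
          rw [← h4 _ h2.1, ← h4 _ h3.1, ← Finset.sum_add_distrib, Finset.mul_sum]
          exact Finset.sum_congr rfl fun j _ => by ring
        · intro e _ he
          rw [dif_neg he, zero_mul])
    obtain ⟨A, hA⟩ := (hd s').mp hev
    let u : Quot r → ZMod 2 := Quot.lift A (by
      rintro x z ⟨e, he, heT, rfl, rfl⟩
      have h1 := hs' e heT
      rw [dif_neg he, hA] at h1
      exact ZMod.two_eq_of_add_eq_zero h1)
    have hy' : y = ∑ w, u w • vec w := by
      funext e
      have h1 := hs' e (hRT e e.2)
      rw [dif_pos e.2, hA] at h1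
      rw [← h1, Finset.sum_apply]
      simp only [Pi.smul_apply, smul_eq_mul, vec, mul_add, Finset.sum_add_distrib]
      simp [u]
    rw [hy']
    refine Submodule.sum_mem _ fun w _ => Submodule.smul_mem _ _ ?_
    by_cases hw : vec w = 0
    · rw [hw]; exact Submodule.zero_mem _
    · refine Submodule.subset_span ?_
      rw [Finset.coe_image]
      exact ⟨w, by simpa [W] using hw, rfl⟩
  have hdim : R.card ≤ J.card + W.card := by
    have h1 := LinearMap.finrank_range_add_finrank_ker bd
    have h2 : Module.finrank (ZMod 2) (LinearMap.range bd) ≤ J.card := by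
      simpa using (LinearMap.range bd).finrank_le
    have h3 : Module.finrank (ZMod 2) (LinearMap.ker bd) ≤ W.card :=
      (Submodule.finrank_mono hspan).trans
        ((finrank_span_finset_le_card _).trans Finset.card_image_le)
    have h4 : Module.finrank (ZMod 2) (R → ZMod 2) = R.card := by simp
    omega
  have hsupp : ∀ w ∈ W, 3 ≤ (Finset.univ.filter fun e => vec w e ≠ 0).card := by
    intro w hw
    have hw0 : vec w ≠ 0 := (Finset.mem_filter.mp hw).2
    refine three_le_card_of_degTwo_eq_zero (a := fun e : R => a e) (b := fun e : R => b e) ?_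
      (fun e _ => hab e e.2) (fun e _ f _ h => Subtype.ext (hinj e e.2 f f.2 h)) fun j => ?_
    · obtain ⟨e, he⟩ := Function.ne_iff.mp hw0
      exact ⟨e, by simpa using he⟩
    · by_cases hj : j ∈ J
      · have h1 := (hd fun e => (if Quot.mk r (p e) = w then 1 else 0) +
          (if Quot.mk r (q e) = w then 1 else 0)).mpr ⟨fun v => if Quot.mk r v = w then 1 else 0,
            fun e => rfl⟩ fun v => if v ∈ K j then 1 else 0
        rw [← Finset.sum_subset (Finset.subset_univ R), ← Finset.sum_coe_sort R] at h1
        · rw [degTwo, Finset.sum_filter]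
          refine Eq.trans (Finset.sum_congr rfl fun e _ => ?_) h1
          have h2 : p' e ∈ K j ↔ a e = j := ⟨fun h => hK _ (ha e e.2).1 _ hj _ (ha e e.2).2 h,
            fun h => h ▸ (ha e e.2).2⟩
          have h3 : q' e ∈ K j ↔ b e = j := ⟨fun h => hK _ (hb e e.2).1 _ hj _ (hb e e.2).2 h,
            fun h => h ▸ (hb e e.2).2⟩
          have h4 : vec w e = 0 ∨ vec w e = 1 := by
            generalize vec w e = x
            revert x; decide
          change _ = vec w e * _
          simp only [h2, h3]
          rcases h4 with h4 | h4 <;> simp [h4]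
        · intro e _ he
          by_cases heT : e ∈ T
          · simp only [hT e heT j hj, ZMod.two_self_add, mul_zero]
          · have : Quot.mk r (p e) = Quot.mk r (q e) := Quot.sound ⟨e, he, heT, rfl, rfl⟩
            rw [this, ZMod.two_self_add, zero_mul]
      · refine Finset.sum_eq_zero fun e _ => ?_
        rw [if_neg (fun h : a e = j => hj (h ▸ (ha e e.2).1)),
          if_neg (fun h : b e = j => hj (h ▸ (hb e e.2).1)),
          add_zero]
  have hcount : 3 * W.card ≤ 2 * R.card := by
    calc 3 * W.card ≤ ∑ w ∈ W, (Finset.univ.filter fun e => vec w e ≠ 0).card := by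
          rw [mul_comm, ← smul_eq_mul]
          exact Finset.card_nsmul_le_sum _ _ _ hsupp
      _ ≤ ∑ w, (Finset.univ.filter fun e => vec w e ≠ 0).card :=
          Finset.sum_le_sum_of_subset (Finset.subset_univ _)
      _ = ∑ e, (Finset.univ.filter fun w => vec w e ≠ 0).card := by
          simp only [Finset.card_filter]
          exact Finset.sum_comm
      _ ≤ ∑ e : R, 2 := by
          refine Finset.sum_le_sum fun e _ => ?_
          refine (Finset.card_le_card (t := {Quot.mk r (p e), Quot.mk r (q e)}) ?_).trans
            Finset.card_le_two
          intro w hw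
          by_contra hw'
          simp only [Finset.mem_insert, Finset.mem_singleton, not_or] at hw'
          simp [vec, Ne.symm hw'.1, Ne.symm hw'.2] at hw
      _ = 2 * R.card := by simp [mul_comm]
  omega

/-- A graph with hereditarily at most three edges per vertex has a large independent set. -/
theorem exists_independent (adj : ι → ι → Prop) (hsymm : ∀ a b, adj a b → adj b a) (J : Finset ι)
    (h : ∀ J' ⊆ J, ∑ a ∈ J', (J'.filter fun b => adj a b).card ≤ 6 * J'.card) :
    ∃ I ⊆ J, J.card ≤ 7 * I.card ∧ ∀ a ∈ I, ∀ b ∈ I, a ≠ b → ¬ adj a b := by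
  induction J using Finset.strongInduction with
  | H J ih =>
    rcases J.eq_empty_or_nonempty with rfl | hne
    · exact ⟨∅, by simp⟩
    obtain ⟨a, haJ, ha⟩ : ∃ a ∈ J, (J.filter fun b => adj a b).card ≤ 6 := by
      by_contra! hcon
      have h1 := Finset.card_nsmul_le_sum J _ 7 fun a ha => hcon a ha
      have h2 := h J subset_rfl
      have := hne.card_pos
      rw [smul_eq_mul] at h1
      omega
    let X := insert a (J.filter fun b => adj a b)
    have hXJ : X ⊆ J := Finset.insert_subset haJ (Finset.filter_subset _ _)
    obtain ⟨I, hI, hcard, hind⟩ := ih (J \ X) (Finset.sdiff_ssubset hXJ ⟨a, by simp [X]⟩)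
      fun J' hJ' => h J' (hJ'.trans Finset.sdiff_subset)
    have hnot : ∀ b ∈ I, ¬ adj a b := fun b hb hadj => by
      have := Finset.mem_sdiff.mp (hI hb)
      exact this.2 (by simp [X, hadj, this.1])
    have haI : a ∉ I := fun h => (Finset.mem_sdiff.mp (hI h)).2 (by simp [X])
    refine ⟨insert a I, Finset.insert_subset haJ (hI.trans Finset.sdiff_subset), ?_, ?_⟩
    · rw [Finset.card_insert_of_notMem haI]
      have h1 : X.card ≤ 7 := (Finset.card_insert_le _ _).trans (by omega)
      have h2 := Finset.card_sdiff_add_card_eq_card hXJ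
      omega
    · intro x hx y hy hxy
      rcases Finset.mem_insert.mp hx with hx | hx <;> rcases Finset.mem_insert.mp hy with hy | hy
      · exact absurd (hx.trans hy.symm) hxy
      · exact hx ▸ hnot y hy
      · exact fun h => hnot x hx (hsymm _ _ (hy ▸ h))
      · exact hind x hx y hy hxy

/-- Among disjoint connected sets of the dual graph, one seventh is pairwise non-adjacent. -/
theorem IsDual.exists_separated [Fintype V] [Fintype ε] {p q : ε → V} {p' q' : ε → F}
    (hd : IsDual p q p' q') (J : Finset ι) (K : ι → Set F) (T : Set ε)
    (hK : ∀ i ∈ J, ∀ j ∈ J, ∀ v ∈ K i, v ∈ K j → i = j)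
    (hT : ∀ e ∈ T, ∀ i ∈ J, p' e ∈ K i ↔ q' e ∈ K i)
    (hconn : ∀ i ∈ J, ∀ U : F → ZMod 2, (∀ e ∈ T, U (p' e) = U (q' e)) →
      ∀ x ∈ K i, ∀ y ∈ K i, U x = U y) :
    ∃ I ⊆ J, J.card ≤ 7 * I.card ∧
      ∀ i ∈ I, ∀ j ∈ I, i ≠ j → ∀ e, p' e ∈ K i → q' e ∉ K j := by
  obtain ⟨I, hI, hcard, hind⟩ := exists_independent
    (fun i j => i ≠ j ∧ ∃ e, (p' e ∈ K i ∧ q' e ∈ K j) ∨ (p' e ∈ K j ∧ q' e ∈ K i))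
    (fun i j ⟨h, e, he⟩ => ⟨h.symm, e, he.symm⟩) J (by
      intro J' hJ'
      rcases J'.eq_empty_or_nonempty with rfl | ⟨i₀, hi₀⟩
      · simp
      have ha : ∀ e, ∃ i, (∃ j ∈ J', p' e ∈ K j) → i ∈ J' ∧ p' e ∈ K i := fun e =>
        if h : ∃ j ∈ J', p' e ∈ K j then ⟨h.choose, fun _ => h.choose_spec⟩ else ⟨i₀, (absurd · h)⟩
      have hb : ∀ e, ∃ i, (∃ j ∈ J', q' e ∈ K j) → i ∈ J' ∧ q' e ∈ K i := fun e =>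
        if h : ∃ j ∈ J', q' e ∈ K j then ⟨h.choose, fun _ => h.choose_spec⟩ else ⟨i₀, (absurd · h)⟩
      choose a ha using ha
      choose b hb using hb
      have hae : ∀ e, ∀ i ∈ J', p' e ∈ K i → a e = i := fun e i hi h =>
        hK _ (hJ' (ha e ⟨i, hi, h⟩).1) _ (hJ' hi) _ (ha e ⟨i, hi, h⟩).2 h
      have hbe : ∀ e, ∀ i ∈ J', q' e ∈ K i → b e = i := fun e i hi h =>
        hK _ (hJ' (hb e ⟨i, hi, h⟩).1) _ (hJ' hi) _ (hb e ⟨i, hi, h⟩).2 h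
      let O : Finset (ι × ι) := (J' ×ˢ J').filter fun x => x.1 ≠ x.2 ∧
        ∃ e, (p' e ∈ K x.1 ∧ q' e ∈ K x.2) ∨ (p' e ∈ K x.2 ∧ q' e ∈ K x.1)
      let Z : Finset (Sym2 ι) := O.image fun x => s(x.1, x.2)
      have hZ : ∀ z : Z, ∃ e, s(a e, b e) = z ∧ a e ≠ b e ∧ (∃ j ∈ J', p' e ∈ K j) ∧
          ∃ j ∈ J', q' e ∈ K j := by
        rintro ⟨z, hz⟩
        obtain ⟨⟨i, j⟩, hij, rfl⟩ := Finset.mem_image.mp hz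
        obtain ⟨hm, hne, e, h | h⟩ := Finset.mem_filter.mp hij
        · have hi := (Finset.mem_product.mp hm).1
          have hj := (Finset.mem_product.mp hm).2
          exact ⟨e, by rw [hae e i hi h.1, hbe e j hj h.2],
            by rw [hae e i hi h.1, hbe e j hj h.2]; exact hne, ⟨i, hi, h.1⟩, ⟨j, hj, h.2⟩⟩
        · have hi := (Finset.mem_product.mp hm).1
          have hj := (Finset.mem_product.mp hm).2
          exact ⟨e, by rw [hae e j hj h.1, hbe e i hi h.2]; exact Sym2.eq_swap,
            by rw [hae e j hj h.1, hbe e i hi h.2]; exact hne.symm, ⟨j, hj, h.1⟩, ⟨i, hi, h.2⟩⟩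
      choose c hc using hZ
      have hcinj : Function.Injective c := fun z z' h => by
        rw [← Subtype.coe_inj, ← (hc z).1, ← (hc z').1, h]
      have hR := hd.card_le J' K T (fun i hi j hj => hK i (hJ' hi) j (hJ' hj))
        (fun e he i hi => hT e he i (hJ' hi)) (fun i hi => hconn i (hJ' hi))
        (Finset.univ.image c) a b
        (by
          intro e he
          obtain ⟨z, -, rfl⟩ := Finset.mem_image.mp he
          exact ha _ (hc z).2.2.1)
        (by
          intro e he
          obtain ⟨z, -, rfl⟩ := Finset.mem_image.mp he
          exact hb _ (hc z).2.2.2)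
        (by
          intro e he
          obtain ⟨z, -, rfl⟩ := Finset.mem_image.mp he
          exact (hc z).2.1)
        (by
          intro e he f hf h
          obtain ⟨z, -, rfl⟩ := Finset.mem_image.mp he
          obtain ⟨z', -, rfl⟩ := Finset.mem_image.mp hf
          rw [(hc z).1, (hc z').1, Subtype.coe_inj] at h
          rw [h])
      rw [Finset.card_image_of_injective _ hcinj, Finset.card_univ, Fintype.card_coe] at hR
      have hO : O.card ≤ 2 * Z.card := by
        refine Finset.card_le_mul_card_image (f := fun x : ι × ι => s(x.1, x.2)) O 2 fun z hz => ?_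
        obtain ⟨⟨i, j⟩, hij, rfl⟩ := Finset.mem_image.mp hz
        refine (Finset.card_le_card
          (t := ({(i, j), (j, i)} : Finset (ι × ι))) ?_).trans Finset.card_le_two
        rintro ⟨x, y⟩ hxy
        have := (Finset.mem_filter.mp hxy).2
        rw [Sym2.eq_iff] at this
        simpa using this
      refine (le_of_eq ?_).trans (hO.trans (show 2 * Z.card ≤ 6 * J'.card by omega))
      simp only [O, Finset.card_filter]
      rw [Finset.sum_product]
      exact Finset.sum_congr rfl fun i _ => Finset.sum_congr rfl fun j _ => by congr)
  exact ⟨I, hI, hcard, fun i hi j hj hij e h1 h2 =>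
    hind i hi j hj hij ⟨hij, e, Or.inl ⟨h1, h2⟩⟩⟩

end Sparsity

section Subdivision
variable {V F ε : Type} {p' q' : ε → F} {l : ε → ℕ}

/-- The vertices along the subdivision of the edge `e` into `l e` pieces. -/
def subPt (p' q' : ε → F) (l : ε → ℕ) (e : ε) (a : ℕ) : F ⊕ (_ : ε) × ℕ :=
  if a = 0 then .inl (p' e) else if a = l e then .inl (q' e) else .inr ⟨e, a⟩

/-- The first end of a piece of a subdivided edge. -/
def subFst (p' q' : ε → F) (l : ε → ℕ) (x : (_ : ε) × ℕ) : F ⊕ (_ : ε) × ℕ :=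
  subPt p' q' l x.1 x.2

/-- The second end of a piece of a subdivided edge. -/
def subSnd (p' q' : ε → F) (l : ε → ℕ) (x : (_ : ε) × ℕ) : F ⊕ (_ : ε) × ℕ :=
  subPt p' q' l x.1 (x.2 + 1)

/-- All pieces of subdivided edges. -/
def subEdges [Fintype ε] (l : ε → ℕ) : Finset ((_ : ε) × ℕ) :=
  Finset.univ.sigma fun e => Finset.range (l e)

theorem mem_subEdges [Fintype ε] {x : (_ : ε) × ℕ} : x ∈ subEdges l ↔ x.2 < l x.1 := by
  simp [subEdges]

theorem subPt_zero (e : ε) : subPt p' q' l e 0 = .inl (p' e) := if_pos rfl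

theorem subPt_length {e : ε} (he : 0 < l e) : subPt p' q' l e (l e) = .inl (q' e) := by
  rw [subPt, if_neg he.ne', if_pos rfl]

theorem sum_range_add_succ (f : ℕ → ZMod 2) (n : ℕ) :
    ∑ a ∈ Finset.range n, (f a + f (a + 1)) = f 0 + f n := by
  induction n with
  | zero => simp [ZMod.two_self_add]
  | succ n ih =>
    rw [Finset.sum_range_succ, ih]
    linear_combination ZMod.two_self_add (f n)

theorem sum_subPt {e : ε} (he : 0 < l e) (U : F ⊕ (_ : ε) × ℕ → ZMod 2) :
    ∑ a ∈ Finset.range (l e), (U (subPt p' q' l e a) + U (subPt p' q' l e (a + 1))) =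
      U (.inl (p' e)) + U (.inl (q' e)) := by
  rw [sum_range_add_succ fun a => U (subPt p' q' l e a), subPt_zero, subPt_length he]

theorem exists_col_sub [Fintype ε] (hl : ∀ e, Even (l e)) :
    ∃ col : F ⊕ (_ : ε) × ℕ → ZMod 2, ∀ x ∈ subEdges l,
      col (subFst p' q' l x) + col (subSnd p' q' l x) = 1 := by
  refine ⟨Sum.elim (fun _ => 0) (fun x => x.2), ?_⟩
  have h : ∀ e a, Sum.elim (fun _ : F => (0 : ZMod 2)) (fun x : (_ : ε) × ℕ => (x.2 : ZMod 2))
      (subPt p' q' l e a) = a := by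
    intro e a
    unfold subPt
    split_ifs with h1 h2
    · simp [h1]
    · simp [h2, (ZMod.natCast_eq_zero_iff_even).mpr (hl e)]
    · simp
  intro x _
  rw [subFst, subSnd, h, h]
  push_cast
  linear_combination ZMod.two_self_add (x.2 : ZMod 2)

theorem EvenSet.mem_iff_of_sub [Fintype ε] {S : Finset ((_ : ε) × ℕ)}
    (hev : EvenSet (subFst p' q' l) (subSnd p' q' l) S) (e : ε) (a : ℕ) (ha : a < l e) :
    (⟨e, a⟩ : (_ : ε) × ℕ) ∈ S ↔ (⟨e, 0⟩ : (_ : ε) × ℕ) ∈ S := by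
  induction a with
  | zero => rfl
  | succ a ih =>
    rw [← ih (by omega)]
    have h1 := hev fun v => if v = .inr ⟨e, a + 1⟩ then 1 else 0
    have hpt : ∀ f b, subPt p' q' l f b = .inr ⟨e, a + 1⟩ ↔ f = e ∧ b = a + 1 := by
      intro f b
      unfold subPt
      split_ifs with h2 h3
      · simp only [false_iff]; omega
      · simp only [false_iff]; rintro ⟨rfl, rfl⟩; omega
      · simp
    have h2 : ∀ x : (_ : ε) × ℕ, ((if subFst p' q' l x = .inr ⟨e, a + 1⟩ then 1 else 0) +
        (if subSnd p' q' l x = .inr ⟨e, a + 1⟩ then 1 else 0) : ZMod 2) =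
        (if x = ⟨e, a + 1⟩ then 1 else 0) + (if x = ⟨e, a⟩ then 1 else 0) := by
      rintro ⟨f, b⟩
      simp only [subFst, subSnd, hpt, Sigma.mk.injEq, heq_eq_eq, Nat.add_right_cancel_iff]
    simp only [h2, Finset.sum_add_distrib, Finset.sum_ite_eq'] at h1
    by_cases c1 : (⟨e, a + 1⟩ : (_ : ε) × ℕ) ∈ S <;>
      by_cases c2 : (⟨e, a⟩ : (_ : ε) × ℕ) ∈ S <;> simp [c1, c2] at h1 ⊢

/-- Even sets of the subdivision are nonnegative when the dual cuts satisfy the cut condition. -/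
theorem IsDual.sub_conservative [Fintype ε] {p q : ε → V} (hd : IsDual p q p' q')
    (w : ε → ℤ) (hl : ∀ e, 0 < l e)
    (hcut : ∀ U : V → ZMod 2, 0 ≤ ∑ e, if U (p e) + U (q e) = 1 then w e * l e else 0)
    (S : Finset ((_ : ε) × ℕ)) (hS : S ⊆ subEdges l)
    (hev : EvenSet (subFst p' q' l) (subSnd p' q' l) S) : 0 ≤ ∑ x ∈ S, w x.1 := by
  have hmem := hev.mem_iff_of_sub
  have hS' : S = (Finset.univ.filter fun e => (⟨e, 0⟩ : (_ : ε) × ℕ) ∈ S).sigma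
      fun e => Finset.range (l e) := by
    ext ⟨e, a⟩
    simp only [Finset.mem_sigma, Finset.mem_filter, Finset.mem_univ, true_and, Finset.mem_range]
    constructor
    · intro h
      have ha : a < l e := mem_subEdges.mp (hS h)
      exact ⟨(hmem e a ha).mp h, ha⟩
    · rintro ⟨h, ha⟩
      exact (hmem e a ha).mpr h
  have hsum : ∀ f : ε → ZMod 2, (∑ e, (if (⟨e, 0⟩ : (_ : ε) × ℕ) ∈ S then 1 else 0) * f e) =
      ∑ e ∈ Finset.univ.filter fun e => (⟨e, 0⟩ : (_ : ε) × ℕ) ∈ S, f e := by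
    intro f
    rw [Finset.sum_filter]
    exact Finset.sum_congr rfl fun e _ => by split_ifs <;> simp
  obtain ⟨U, hU⟩ := (hd fun e => if (⟨e, 0⟩ : (_ : ε) × ℕ) ∈ S then 1 else 0).mp (by
    intro U
    have h1 := hev (Sum.elim U fun _ => 0)
    rw [hS', Finset.sum_sigma] at h1
    rw [hsum]
    refine Eq.trans (Finset.sum_congr rfl fun e _ => ?_) h1
    exact (sum_subPt (hl e) (Sum.elim U fun _ => 0)).symm)
  have h2 := hcut U
  rw [hS', Finset.sum_sigma, Finset.sum_filter]
  refine h2.trans (le_of_eq (Finset.sum_congr rfl fun e _ => ?_))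
  rw [← hU]
  by_cases h : (⟨e, 0⟩ : (_ : ε) × ℕ) ∈ S
  · simp [h, mul_comm]
  · simp [h]

/-- The original vertices on the component of the sublevel set at `x`. -/
def lowComp [Fintype ε] (p' q' : ε → F) (l : ε → ℕ) (h : F ⊕ (_ : ε) × ℕ → ℤ) (i : ℤ)
    (x : F ⊕ (_ : ε) × ℕ) : Set F :=
  {v | h (.inl v) ≤ i ∧ LevelConn (subFst p' q' l) (subSnd p' q' l) (subEdges l) h i x (.inl v)}

theorem LevelConn.trans {p q : ε → V} {A : Finset ε} {h : V → ℤ} {i : ℤ} {x y z : V}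
    (h1 : LevelConn p q A h i x y) (h2 : LevelConn p q A h i y z) : LevelConn p q A h i x z :=
  fun U hU => (h1 U hU).trans (h2 U hU)

theorem LevelConn.symm {p q : ε → V} {A : Finset ε} {h : V → ℤ} {i : ℤ} {x y : V}
    (h1 : LevelConn p q A h i x y) : LevelConn p q A h i y x := fun U hU => (h1 U hU).symm

theorem LevelConn.of_edge {p q : ε → V} {A : Finset ε} {h : V → ℤ} {i : ℤ} {e : ε} (he : e ∈ A)
    (h1 : h (p e) ≤ i) (h2 : h (q e) ≤ i) : LevelConn p q A h i (p e) (q e) :=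
  fun _ hU => hU e he h1 h2

theorem levelConn_sub [Fintype ε] {h : F ⊕ (_ : ε) × ℕ → ℤ} {i : ℤ} {e : ε} (he : 0 < l e)
    (hi : ∀ a ≤ l e, h (subPt p' q' l e a) ≤ i) :
    LevelConn (subFst p' q' l) (subSnd p' q' l) (subEdges l) h i (.inl (p' e)) (.inl (q' e)) := by
  have : ∀ a ≤ l e, LevelConn (subFst p' q' l) (subSnd p' q' l) (subEdges l) h i
      (subPt p' q' l e 0) (subPt p' q' l e a) := by
    intro a
    induction a with
    | zero => exact fun _ U _ => rfl
    | succ a ih =>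
      intro ha
      exact (ih (by omega)).trans (LevelConn.of_edge (e := (⟨e, a⟩ : (_ : ε) × ℕ))
        (mem_subEdges.mpr ha) (hi a (by omega)) (hi (a + 1) ha))
  have h1 := this (l e) le_rfl
  rwa [subPt_zero, subPt_length he] at h1

theorem mem_lowComp_iff [Fintype ε] {h : F ⊕ (_ : ε) × ℕ → ℤ} {i : ℤ} {e : ε} (he : 0 < l e)
    (hi : ∀ a ≤ l e, h (subPt p' q' l e a) ≤ i) (x : F ⊕ (_ : ε) × ℕ) :
    p' e ∈ lowComp p' q' l h i x ↔ q' e ∈ lowComp p' q' l h i x := by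
  have h1 := hi 0 (Nat.zero_le _)
  have h2 := hi (l e) le_rfl
  rw [subPt_zero] at h1
  rw [subPt_length he] at h2
  have h3 := levelConn_sub he hi
  exact ⟨fun h => ⟨h2, h.2.trans h3⟩, fun h => ⟨h1, h.2.trans h3.symm⟩⟩

/-- The original vertices of a sublevel component are connected by the edges whose
subdivisions stay below the level. -/
theorem lowComp_connected [Fintype ε] {h : F ⊕ (_ : ε) × ℕ → ℤ} {i : ℤ} (hl : ∀ e, 0 < l e)
    (x : F ⊕ (_ : ε) × ℕ) (U : F → ZMod 2)
    (hU : ∀ e, (∀ a ≤ l e, h (subPt p' q' l e a) ≤ i) → U (p' e) = U (q' e)) :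
    ∀ v ∈ lowComp p' q' l h i x, ∀ v' ∈ lowComp p' q' l h i x, U v = U v' := by
  let G : ε → ℕ → ZMod 2 := fun e a =>
    if ∀ b ≤ a, h (subPt p' q' l e b) ≤ i then U (p' e) else U (q' e)
  let W : F ⊕ (_ : ε) × ℕ → ZMod 2 := Sum.elim U fun y => G y.1 y.2
  have hWG : ∀ e, ∀ a ≤ l e, h (subPt p' q' l e a) ≤ i → W (subPt p' q' l e a) = G e a := by
    intro e a ha hi
    by_cases h0 : a = 0
    · subst h0
      rw [subPt_zero] at hi ⊢
      have : ∀ b ≤ 0, h (subPt p' q' l e b) ≤ i := by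
        intro b hb
        rw [Nat.le_zero.mp hb, subPt_zero]; exact hi
      simp only [G, if_pos this, W, Sum.elim_inl]
    · by_cases h1 : a = l e
      · subst h1
        rw [subPt_length (hl e)]
        simp only [W, Sum.elim_inl, G]
        split_ifs with h2
        · exact (hU e h2).symm
        · rfl
      · simp only [subPt, if_neg h0, if_neg h1, W, Sum.elim_inr]
  have hW : ∀ y ∈ subEdges l, h (subFst p' q' l y) ≤ i → h (subSnd p' q' l y) ≤ i →
      W (subFst p' q' l y) = W (subSnd p' q' l y) := by
    rintro ⟨e, a⟩ hy h1 h2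
    have ha : a < l e := mem_subEdges.mp hy
    simp only [subFst, subSnd] at h1 h2 ⊢
    rw [hWG e a ha.le h1, hWG e (a + 1) ha h2]
    have : (∀ b ≤ a, h (subPt p' q' l e b) ≤ i) ↔ ∀ b ≤ a + 1, h (subPt p' q' l e b) ≤ i := by
      constructor
      · intro h3 b hb
        rcases Nat.le_succ_iff.mp hb with hb | rfl
        · exact h3 b hb
        · exact h2
      · exact fun h3 b hb => h3 b (by omega)
    simp only [G, this]
  intro v hv v' hv'
  exact (hv.2 W hW).symm.trans (hv'.2 W hW)

end Subdivision

theorem not_iff_iff_of_indicator {P Q R : Prop}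
    (h : (if R then 1 else 0 : ZMod 2) = (if P then 1 else 0) + if Q then 1 else 0) :
    ¬(P ↔ Q) ↔ R := by
  have h2 : (1 : ZMod 2) + 1 = 0 := ZMod.two_self_add 1
  by_cases c1 : P <;> by_cases c2 : Q <;> by_cases c3 : R <;> simp [c1, c2, c3, h2] at h ⊢

section Levels
variable {V F ε : Type} {p' q' : ε → F} {l : ε → ℕ}

/-- Among the pieces which are the only one of their kind at the bottom of a sublevel component,
exactly one leaves the component. -/
theorem lowComp_cut_iff [Fintype ε] {h : F ⊕ (_ : ε) × ℕ → ℤ} (hl : ∀ e, 0 < l e)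
    (hh : ∀ x ∈ subEdges l, |h (subFst p' q' l x) - h (subSnd p' q' l x)| = 1)
    (Dem : Finset ε) {y : (_ : ε) × ℕ} (hy : y ∈ subEdges l)
    (huniq : ∀ x ∈ subEdges l, x.1 ∈ Dem →
      h (lowEnd (subFst p' q' l) (subSnd p' q' l) h y) =
        h (lowEnd (subFst p' q' l) (subSnd p' q' l) h x) →
      LevelConn (subFst p' q' l) (subSnd p' q' l) (subEdges l) h
        (h (lowEnd (subFst p' q' l) (subSnd p' q' l) h y))
        (lowEnd (subFst p' q' l) (subSnd p' q' l) h y)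
        (lowEnd (subFst p' q' l) (subSnd p' q' l) h x) → y = x)
    {e : ε} (he : e ∈ Dem) {K : Set F}
    (hK : K = lowComp p' q' l h (h (lowEnd (subFst p' q' l) (subSnd p' q' l) h y))
        (lowEnd (subFst p' q' l) (subSnd p' q' l) h y)) :
    ¬(p' e ∈ K ↔ q' e ∈ K) ↔ e = y.1 := by
  set low := lowEnd (subFst p' q' l) (subSnd p' q' l) h with hlow
  set i := h (low y) with hi
  let κ : F ⊕ (_ : ε) × ℕ → ZMod 2 := fun v =>
    if h v ≤ i ∧ LevelConn (subFst p' q' l) (subSnd p' q' l) (subEdges l) h i (low y) v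
    then 1 else 0
  have hmin : ∀ x, h (low x) = min (h (subFst p' q' l x)) (h (subSnd p' q' l x)) :=
    height_lowEnd _ _ _
  have hor : ∀ x, low x = subFst p' q' l x ∨ low x = subSnd p' q' l x := lowEnd_eq_or _ _ _
  have hκ : ∀ x ∈ subEdges l, x.1 ∈ Dem →
      κ (subFst p' q' l x) + κ (subSnd p' q' l x) = if x = y then 1 else 0 := by
    intro x hx hxD
    have h1 := hh x hx
    have h2 := hmin x
    have hlow1 : i < h (subFst p' q' l x) → κ (subFst p' q' l x) = 0 :=
      fun h3 => if_neg fun h4 => absurd h4.1 (not_le.mpr h3)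
    have hlow2 : i < h (subSnd p' q' l x) → κ (subSnd p' q' l x) = 0 :=
      fun h3 => if_neg fun h4 => absurd h4.1 (not_le.mpr h3)
    by_cases hxi : h (low x) = i
    · have hκlow : κ (low x) = if x = y then 1 else 0 := by
        by_cases hxy : x = y
        · rw [if_pos hxy, hxy]
          exact if_pos ⟨le_rfl, fun _ _ => rfl⟩
        · rw [if_neg hxy]
          exact if_neg fun h4 => hxy (huniq x hx hxD hxi.symm h4.2).symm
      rcases hor x with h3 | h3
      · have h4 : i < h (subSnd p' q' l x) := by
          rw [← h3, hxi] at h1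
          rw [hxi, ← h3, hxi] at h2
          rcases abs_eq (zero_le_one' ℤ) |>.mp h1 with h5 | h5 <;> omega
        rw [hlow2 h4, ← h3, hκlow, add_zero]
      · have h4 : i < h (subFst p' q' l x) := by
          rw [← h3, hxi] at h1
          rw [hxi, ← h3, hxi] at h2
          rcases abs_eq (zero_le_one' ℤ) |>.mp h1 with h5 | h5 <;> omega
        rw [hlow1 h4, ← h3, hκlow, zero_add]
    · have hxy : x ≠ y := fun h3 => hxi (by rw [h3])
      rw [if_neg hxy]
      rcases lt_or_gt_of_ne hxi with h3 | h3
      · have h4 : h (subFst p' q' l x) ≤ i ∧ h (subSnd p' q' l x) ≤ i := by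
          rcases abs_eq (zero_le_one' ℤ) |>.mp h1 with h5 | h5 <;> omega
        have h5 := LevelConn.of_edge hx h4.1 h4.2
        have h6 : κ (subFst p' q' l x) = κ (subSnd p' q' l x) := by
          simp only [κ, h4.1, h4.2, true_and]
          exact if_congr ⟨fun h6 => h6.trans h5, fun h6 => h6.trans h5.symm⟩ rfl rfl
        rw [h6, ZMod.two_self_add]
      · rw [hlow1 (by omega), hlow2 (by omega), add_zero]
  have hsum := sum_subPt (p' := p') (q' := q') (hl e) κ
  have hκ' : ∀ v : F, κ (.inl v) = if v ∈ K then 1 else 0 := by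
    intro v
    rw [hK]
    exact if_congr Iff.rfl rfl rfl
  have h3 : ∑ a ∈ Finset.range (l e), (κ (subPt p' q' l e a) + κ (subPt p' q' l e (a + 1))) =
      if e = y.1 then 1 else 0 := by
    refine (Finset.sum_congr rfl fun a ha =>
      hκ ⟨e, a⟩ (mem_subEdges.mpr (Finset.mem_range.mp ha)) he).trans ?_
    by_cases hey : e = y.1
    · subst hey
      have h4 : ∀ a, (⟨y.1, a⟩ : (_ : ε) × ℕ) = y ↔ a = y.2 := by
        rintro a
        obtain ⟨f, b⟩ := y
        simp
      simp only [h4, Finset.sum_ite_eq', Finset.mem_range, if_pos (mem_subEdges.mp hy), if_true]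
    · rw [if_neg hey]
      exact Finset.sum_eq_zero fun a _ => if_neg fun h4 => hey (by rw [← h4])
  rw [h3, hκ', hκ'] at hsum
  exact not_iff_iff_of_indicator hsum

theorem abs_height_sub_le [Fintype ε] {h : F ⊕ (_ : ε) × ℕ → ℤ}
    (hh : ∀ x ∈ subEdges l, |h (subFst p' q' l x) - h (subSnd p' q' l x)| = 1) (e : ε)
    {a b : ℕ} (ha : a ≤ l e) (hb : b ≤ l e) :
    h (subPt p' q' l e a) ≤ h (subPt p' q' l e b) + l e := by
  have key : ∀ c d : ℕ, c + d ≤ l e →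
      |h (subPt p' q' l e c) - h (subPt p' q' l e (c + d))| ≤ d := by
    intro c d
    induction d with
    | zero => simp
    | succ d ih =>
      intro hcd
      have h1 := ih (by omega)
      have h2 : |h (subPt p' q' l e (c + d)) - h (subPt p' q' l e (c + d + 1))| = 1 :=
        hh ⟨e, c + d⟩ (mem_subEdges.mpr hcd)
      have h3 := abs_sub_le (h (subPt p' q' l e c)) (h (subPt p' q' l e (c + d)))
        (h (subPt p' q' l e (c + (d + 1))))
      rw [← add_assoc] at h3 ⊢
      push_cast
      omega
  rcases le_total a b with hab | hab
  · have := abs_le.mp (key a (b - a) (by omega))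
    rw [show a + (b - a) = b by omega] at this
    omega
  · have := abs_le.mp (key b (a - b) (by omega))
    rw [show b + (a - b) = a by omega] at this
    omega

theorem exists_heights_of_cut [Fintype ε] {h : F ⊕ (_ : ε) × ℕ → ℤ} (hl : ∀ e, 0 < l e) {i : ℤ}
    {z : F ⊕ (_ : ε) × ℕ} {e : ε}
    (he : ¬(p' e ∈ lowComp p' q' l h i z ↔ q' e ∈ lowComp p' q' l h i z)) :
    (∃ a ≤ l e, h (subPt p' q' l e a) ≤ i) ∧ ∃ a ≤ l e, i < h (subPt p' q' l e a) := by
  constructor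
  · by_cases h1 : p' e ∈ lowComp p' q' l h i z
    · exact ⟨0, Nat.zero_le _, by rw [subPt_zero]; exact h1.1⟩
    · have h2 : q' e ∈ lowComp p' q' l h i z := by tauto
      exact ⟨l e, le_rfl, by rw [subPt_length (hl e)]; exact h2.1⟩
  · by_contra! h1
    exact he (mem_lowComp_iff (hl e) h1 z)

end Levels

theorem exists_residue_class {α : Type} (R : Finset α) (f : α → ℤ) (M : ℕ) (hM : 0 < M) :
    ∃ θ : ℤ, R.card ≤ M * (R.filter fun x => f x % M = θ).card := by
  have hMpos : (0 : ℤ) < M := by exact_mod_cast hM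
  obtain ⟨θ, -, hθ⟩ := Finset.exists_max_image (Finset.Ico (0 : ℤ) M)
    (fun θ => (R.filter fun x => f x % M = θ).card) ⟨0, by simpa using hM⟩
  refine ⟨θ, ?_⟩
  rw [Finset.card_eq_sum_card_fiberwise (f := fun x => f x % M) (t := Finset.Ico (0 : ℤ) M)]
  · refine (Finset.sum_le_card_nsmul _ _ _ hθ).trans (le_of_eq ?_)
    simp
  · intro x _
    simp only [Finset.coe_Ico, Set.mem_Ico]
    exact ⟨Int.emod_nonneg _ hMpos.ne', Int.emod_lt_of_pos _ hMpos⟩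

/-- Many disjoint even sets with one demand edge each, from the cut condition with
multiplicities. -/
theorem IsDual.exists_evenSets {V F ε : Type} [Fintype V] [Fintype ε] {p q : ε → V}
    {p' q' : ε → F} (hd : IsDual p q p' q') (Dem : Finset ε) (n : ε → ℕ) (N : ℕ) (hN : 0 < N)
    (hn : ∀ e ∈ Dem, 0 < n e ∧ n e ≤ N)
    (hcut : ∀ U : V → ZMod 2, 0 ≤ ∑ e, if U (p e) + U (q e) = 1 then
      (if e ∈ Dem then -(n e : ℤ) else N) else 0) :
    ∃ (I : Finset ((_ : ε) × ℕ)) (S : (_ : ε) × ℕ → Finset ε),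
      (∀ x ∈ I, EvenSet p q (S x)) ∧ (∀ x ∈ I, ∃ e ∈ Dem, ∀ f ∈ Dem, f ∈ S x ↔ f = e) ∧
      (∀ x ∈ I, ∀ y ∈ I, x ≠ y → Disjoint (S x) (S y)) ∧
      ∑ e ∈ Dem, n e ≤ 7 * N * I.card := by
  set l : ε → ℕ := fun e => if e ∈ Dem then 2 * n e else 2 * N with hl_def
  set w : ε → ℤ := fun e => if e ∈ Dem then -1 else 1 with hw_def
  have hl : ∀ e, 0 < l e := by
    intro e
    simp only [hl_def]
    split_ifs with he
    · have := hn e he; omega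
    · omega
  have hlM : ∀ e, l e ≤ 2 * N := by
    intro e
    simp only [hl_def]
    split_ifs with he
    · have := hn e he; omega
    · omega
  have hleven : ∀ e, Even (l e) := by
    intro e
    simp only [hl_def]
    split_ifs <;> exact even_two_mul _
  have hw : ∀ e, w e = 1 ∨ w e = -1 := by
    intro e
    simp only [hw_def]
    split_ifs <;> simp
  have hwD : ∀ e, w e = -1 ↔ e ∈ Dem := by
    intro e
    simp only [hw_def]
    split_ifs with he <;> simp [he]
  have hcut' : ∀ U : V → ZMod 2, 0 ≤ ∑ e, if U (p e) + U (q e) = 1 then w e * l e else 0 := by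
    intro U
    have h1 := mul_nonneg (zero_le_two (α := ℤ)) (hcut U)
    rw [Finset.mul_sum] at h1
    refine h1.trans (le_of_eq (Finset.sum_congr rfl fun e _ => ?_))
    simp only [hw_def, hl_def]
    split_ifs <;> push_cast <;> ring
  obtain ⟨h, hh, huniq⟩ := exists_height (fun x : (_ : ε) × ℕ => w x.1) (fun x => hw x.1)
    (subEdges l) (subFst p' q' l) (subSnd p' q' l) (exists_col_sub hleven)
    (hd.sub_conservative w hl hcut')
  set low := lowEnd (subFst p' q' l) (subSnd p' q' l) h with hlow
  let K : (_ : ε) × ℕ → Set F := fun x => lowComp p' q' l h (h (low x)) (low x)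
  let S : (_ : ε) × ℕ → Finset ε := fun x => Finset.univ.filter fun e => ¬(p' e ∈ K x ↔ q' e ∈ K x)
  set R := (subEdges l).filter fun x => x.1 ∈ Dem with hR
  have hmemR : ∀ x, x ∈ R ↔ x ∈ subEdges l ∧ x.1 ∈ Dem := fun x => Finset.mem_filter
  have huniq' : ∀ x ∈ R, ∀ y ∈ R, h (low x) = h (low y) → ∀ v ∈ K x, v ∈ K y → x = y := by
    intro x hx y hy hxy v hvx hvy
    rw [hmemR] at hx hy
    refine huniq x hx.1 y hy.1 ((hwD _).mpr hx.2) ((hwD _).mpr hy.2) hxy ?_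
    have h1 := hvy.2
    rw [← hxy] at h1
    exact hvx.2.trans h1.symm
  have hlevel : ∀ i : ℤ, ∃ I ⊆ R.filter fun x => h (low x) = i,
      (R.filter fun x => h (low x) = i).card ≤ 7 * I.card ∧
      ∀ x ∈ I, ∀ y ∈ I, x ≠ y → ∀ e, p' e ∈ K x → q' e ∉ K y := by
    intro i
    refine hd.exists_separated (R.filter fun x => h (low x) = i) K
      {e | ∀ a ≤ l e, h (subPt p' q' l e a) ≤ i} ?_ ?_ ?_
    · intro x hx y hy v hvx hvy
      rw [Finset.mem_filter] at hx hy
      exact huniq' x hx.1 y hy.1 (hx.2.trans hy.2.symm) v hvx hvy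
    · intro e he x hx
      rw [Finset.mem_filter] at hx
      exact mem_lowComp_iff (hl e) (by rw [hx.2]; exact he) _
    · intro x hx U hU
      rw [Finset.mem_filter] at hx
      exact lowComp_connected hl (low x) U (by rw [hx.2]; exact hU)
  choose I₀ hI₀ hcard hsep using hlevel
  obtain ⟨θ, hθ⟩ := exists_residue_class R (fun x => h (low x)) (2 * N) (by omega)
  set Q := R.filter fun x => h (low x) % (2 * N : ℕ) = θ with hQ
  set I := Q.filter fun x => x ∈ I₀ (h (low x)) with hI
  have hmemI : ∀ x ∈ I, x ∈ R ∧ h (low x) % (2 * N : ℕ) = θ ∧ x ∈ I₀ (h (low x)) := by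
    intro x hx
    simp only [hI, hQ, Finset.mem_filter] at hx
    exact ⟨hx.1.1, hx.1.2, hx.2⟩
  refine ⟨I, S, ?_, ?_, ?_, ?_⟩
  · intro x _ U
    have h1 := (hd fun e => U (p e) + U (q e)).mpr ⟨U, fun e => rfl⟩
      fun v => if v ∈ K x then 1 else 0
    rw [Finset.sum_filter]
    refine Eq.trans (Finset.sum_congr rfl fun e _ => ?_) h1
    by_cases c1 : p' e ∈ K x <;> by_cases c2 : q' e ∈ K x <;> simp [c1, c2, ZMod.two_self_add]
  · intro x hx
    have hxR := (hmemR x).mp (hmemI x hx).1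
    refine ⟨x.1, hxR.2, fun f hf => ?_⟩
    simp only [S, Finset.mem_filter, Finset.mem_univ, true_and]
    exact lowComp_cut_iff hl hh Dem hxR.1 (fun y hy hyD => huniq x hxR.1 y hy ((hwD _).mpr hxR.2)
      ((hwD _).mpr hyD)) hf rfl
  · intro x hx y hy hxy
    rw [Finset.disjoint_left]
    intro e hex hey
    simp only [S, Finset.mem_filter, Finset.mem_univ, true_and] at hex hey
    obtain ⟨hxR, hxθ, hxI⟩ := hmemI x hx
    obtain ⟨hyR, hyθ, hyI⟩ := hmemI y hy
    have hM := hlM e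
    obtain ⟨⟨a, ha, ha'⟩, b, hb, hb'⟩ := exists_heights_of_cut hl hex
    obtain ⟨⟨c, hc, hc'⟩, d, hd', hd''⟩ := exists_heights_of_cut hl hey
    have h1 := abs_height_sub_le hh e hb hc
    have h2 := abs_height_sub_le hh e hd' ha
    have hlev : h (low x) = h (low y) := by
      have h3 : ((2 * N : ℕ) : ℤ) ∣ h (low x) - h (low y) :=
        Int.dvd_of_emod_eq_zero (Int.emod_eq_emod_iff_emod_sub_eq_zero.mp (hxθ.trans hyθ.symm))
      have h4 : |h (low x) - h (low y)| < ((2 * N : ℕ) : ℤ) := by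
        rw [abs_lt]; constructor <;> omega
      have := Int.eq_zero_of_abs_lt_dvd h3 h4
      omega
    rw [← hlev] at hyI
    have h3 := hsep _ x hxI y hyI hxy e
    have h4 := hsep _ y hyI x hxI hxy.symm e
    have h5 := huniq' x hxR y hyR hlev
    have h6 := fun hp hq => hxy (h5 (p' e) hp hq)
    have h7 := fun hp hq => hxy (h5 (q' e) hp hq)
    tauto
  · have hRcard : R.card = ∑ e ∈ Dem, 2 * n e := by
      have : R = Dem.sigma fun e => Finset.range (l e) := by
        ext x
        rw [hmemR, mem_subEdges, Finset.mem_sigma, Finset.mem_range, and_comm]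
      rw [this, Finset.card_sigma]
      exact Finset.sum_congr rfl fun e he => by simp [hl_def, he]
    have hQI : Q.card ≤ 7 * I.card := by
      rw [Finset.card_eq_sum_card_fiberwise (s := Q) (f := fun x => h (low x))
        (t := Q.image fun x => h (low x)) fun x hx => Finset.mem_image_of_mem _ hx,
        Finset.card_eq_sum_card_fiberwise (s := I) (f := fun x => h (low x))
        (t := Q.image fun x => h (low x)) fun x hx =>
          Finset.mem_image_of_mem _ (Finset.filter_subset _ _ hx), Finset.mul_sum]
      refine Finset.sum_le_sum fun i hi => ?_
      obtain ⟨z, hz, hzi⟩ := Finset.mem_image.mp hi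
      have hiθ : i % (2 * N : ℕ) = θ := by rw [← hzi]; exact (Finset.mem_filter.mp hz).2
      refine (Finset.card_le_card ?_).trans ((hcard i).trans
        (Nat.mul_le_mul_left 7 (Finset.card_le_card ?_)))
      · exact Finset.filter_subset_filter _ (Finset.filter_subset _ _)
      · intro x hx
        have h1 := Finset.mem_filter.mp (hI₀ i hx)
        simp only [hI, hQ, Finset.mem_filter]
        exact ⟨⟨⟨h1.1, by rw [h1.2]; exact hiθ⟩, by rw [h1.2]; exact hx⟩, h1.2⟩
    rw [hRcard, ← Finset.mul_sum] at hθ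
    nlinarith

/-- Every edge of an even set lies on a cycle inside that set. -/
theorem EvenSet.exists_isCycle {V ε : Type} {p q : ε → V} {ends : ε → Sym2 V}
    (hends : ∀ e, ends e = s(p e, q e)) {S : Finset ε} (hS : EvenSet p q S) {e₀ : ε}
    (he₀ : e₀ ∈ S) : ∃ C ⊆ S, e₀ ∈ C ∧ IsCycle ends C := by
  let G : SimpleGraph V :=
    { Adj := fun a b => a ≠ b ∧ ∃ e ∈ S, e ≠ e₀ ∧ ends e = s(a, b)
      symm := ⟨fun a b ⟨h1, e, h2, h3, h4⟩ => ⟨h1.symm, e, h2, h3, by rw [h4, Sym2.eq_swap]⟩⟩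
      loopless := ⟨fun a h => h.1 rfl⟩ }
  have hreach : G.Reachable (p e₀) (q e₀) := by
    by_contra hcon
    have h1 := hS fun v => if G.Reachable (p e₀) v then 1 else 0
    rw [Finset.sum_eq_single_of_mem e₀ he₀] at h1
    · simp [hcon] at h1
    · intro e he hee
      have h2 : G.Reachable (p e₀) (p e) ↔ G.Reachable (p e₀) (q e) := by
        by_cases hpq : p e = q e
        · rw [hpq]
        · have h3 : G.Adj (p e) (q e) := ⟨hpq, e, he, hee, hends e⟩
          exact ⟨fun h => h.trans h3.reachable, fun h => h.trans h3.symm.reachable⟩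
      simp only [h2, ZMod.two_self_add]
  obtain ⟨W, hW⟩ := hreach.exists_isPath
  have hadj : ∀ i : Fin (W.length + 1), i.val < W.length →
      ∃ e ∈ S, e ≠ e₀ ∧ ends e = s(W.getVert i, W.getVert (i + 1)) :=
    fun i hi => (W.adj_getVert_succ hi).2
  have : Nonempty ε := ⟨e₀⟩
  choose! f hfS hf₀ hf using hadj
  have hinj : ∀ i j, i ≤ W.length → j ≤ W.length → W.getVert i = W.getVert j → i = j :=
    fun i j hi hj h => hW.getVert_injOn hi hj h
  let g : Fin (W.length + 1) → ε := fun i => if i.val < W.length then f i else e₀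
  have hg : ∀ i, g i ∈ S := by
    intro i
    simp only [g]
    split_ifs with h
    exacts [hfS i h, he₀]
  refine ⟨Finset.image g Finset.univ, ?_, ?_, W.length, fun i => W.getVert i, g, ?_, ?_, ?_, rfl⟩
  · intro e he
    obtain ⟨i, -, rfl⟩ := Finset.mem_image.mp he
    exact hg i
  · exact Finset.mem_image.mpr ⟨Fin.last _, Finset.mem_univ _, by simp [g]⟩
  · intro i j hij
    exact Fin.ext (hinj i j (Nat.lt_succ_iff.mp i.2) (Nat.lt_succ_iff.mp j.2) hij)
  · intro i j hij
    simp only [g] at hij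
    split_ifs at hij with h1 h2 h2
    · have h3 := (hf i h1).symm.trans ((congrArg ends hij).trans (hf j h2))
      rw [Sym2.eq_iff] at h3
      rcases h3 with ⟨h3, -⟩ | ⟨h3, h4⟩
      · exact Fin.ext (hinj _ _ h1.le h2.le h3)
      · have h5 := hinj _ _ h1.le h2 h3
        have h6 := hinj _ _ h1 h2.le h4
        omega
    · exact absurd hij (hf₀ i h1)
    · exact absurd hij.symm (hf₀ j h2)
    · exact Fin.ext (by omega)
  · intro i
    simp only [g]
    split_ifs with h1
    · rw [hf i h1, Fin.val_add_one_of_lt (Fin.lt_def.mpr (by simpa using h1))]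
    · have h2 : i = Fin.last _ := Fin.ext (by simp; omega)
      rw [h2, Fin.last_add_one, hends, Sym2.eq_swap]
      simp

theorem IsCycle.singleton {V ε : Type} {ends : ε → Sym2 V} {e : ε} {v : V}
    (h : ends e = s(v, v)) : IsCycle ends {e} :=
  ⟨0, fun _ => v, fun _ => e, fun i j _ => by omega, fun i j _ => by omega,
    fun _ => h, by simp⟩

theorem IsCycle.map_subtype {V ε : Type} {P : ε → Prop} {ends : ε → Sym2 V}
    {C : Finset (Subtype P)} (h : IsCycle (fun e : Subtype P => ends e) C) :
    IsCycle ends (C.map (Function.Embedding.subtype P)) := by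
  obtain ⟨n, v, e, hv, he, hends, rfl⟩ := h
  refine ⟨n, v, fun i => e i, hv, Subtype.val_injective.comp he, hends, ?_⟩
  ext f
  simp

theorem mem_cutF_iff {V ε : Type} [Fintype ε] {ends : ε → Sym2 V} {p q : ε → V}
    (hends : ∀ e, ends e = s(p e, q e)) (U : V → ZMod 2) (e : ε) :
    e ∈ cutF ends {v | U v = 1} ↔ U (p e) + U (q e) = 1 := by
  have key : ∀ x y : ZMod 2, x + y = 1 ↔ (x = 1 ∧ y ≠ 1) ∨ (y = 1 ∧ x ≠ 1) := by decide
  simp only [cutF, Finset.mem_filter, Finset.mem_univ, true_and, Set.mem_ofPred_eq, key, hends]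
  constructor
  · rintro ⟨a, b, hab, ha, hb⟩
    rcases Sym2.eq_iff.mp hab with ⟨h1, h2⟩ | ⟨h1, h2⟩
    · exact Or.inl ⟨by rw [h1]; exact ha, by rw [h2]; exact hb⟩
    · exact Or.inr ⟨by rw [h2]; exact ha, by rw [h1]; exact hb⟩
  · rintro (⟨h1, h2⟩ | ⟨h1, h2⟩)
    · exact ⟨p e, q e, rfl, h1, h2⟩
    · exact ⟨q e, p e, Sym2.eq_swap, h1, h2⟩

/-- The rounding bound for demand edges that are not loops. -/
theorem exists_disjoint_cycles {V ε : Type} [Fintype V] [Fintype ε] {ends : ε → Sym2 V}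
    {p q : ε → V} (hends : ∀ e, ends e = s(p e, q e)) (pos : V → ℝ × ℝ) (arc : ε → ℝ → ℝ × ℝ)
    (hpos : Function.Injective pos) (hcont : ∀ e, ContinuousOn (arc e) (Set.Icc 0 1))
    (h0 : ∀ e, arc e 0 = pos (p e)) (h1 : ∀ e, arc e 1 = pos (q e))
    (hdisj : ∀ e f, e ≠ f → ∀ s ∈ Set.Ioo (0:ℝ) 1, ∀ t ∈ Set.Icc (0:ℝ) 1, arc e s ≠ arc f t)
    (hvert : ∀ e, ∀ s ∈ Set.Ioo (0:ℝ) 1, ∀ w, arc e s ≠ pos w)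
    (Dem : Finset ε) (x : ε → ℝ) (hx01 : ∀ e ∈ Dem, 0 ≤ x e ∧ x e ≤ 1)
    (hxcut : ∀ U : Set V,
      ∑ e ∈ cutF ends U ∩ Dem, x e ≤ ((cutF ends U \ Dem).card : ℝ)) :
    ∃ (ι : Type) (I : Finset ι) (C : ι → Finset ε),
      (∀ i ∈ I, IsCycle ends (C i)) ∧
      (∀ i ∈ I, ∃ e ∈ Dem, ∀ f ∈ Dem, f ∈ C i ↔ f = e) ∧
      (∀ i ∈ I, ∀ e ∈ C i, p e ≠ q e) ∧
      (∀ i ∈ I, ∀ j ∈ I, i ≠ j → Disjoint (C i) (C j)) ∧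
      ∑ e ∈ Dem.filter (fun e => p e ≠ q e), x e ≤ 14 * (I.card : ℝ) := by
  set X := ∑ e ∈ Dem.filter (fun e => p e ≠ q e), x e with hX
  rcases le_or_gt X 0 with hX0 | hX0
  · exact ⟨Empty, ∅, fun _ => ∅, by simp, by simp, by simp, by simp, by simpa using hX0⟩
  obtain ⟨N, hN⟩ := exists_nat_gt (2 * (Dem.card : ℝ) / X)
  have hN0 : 0 < N := by
    have : (0 : ℝ) < N := lt_of_le_of_lt (by positivity) hN
    exact_mod_cast this
  rw [div_lt_iff₀ hX0] at hN
  let n : ε → ℕ := fun e => ⌊N * x e⌋₊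
  have hnx : ∀ e ∈ Dem, (n e : ℝ) ≤ N * x e := fun e he =>
    Nat.floor_le (mul_nonneg (Nat.cast_nonneg _) (hx01 e he).1)
  have hxn : ∀ e, N * x e ≤ n e + 1 := fun e => (Nat.lt_floor_add_one _).le
  let P : ε → Prop := fun e => p e ≠ q e ∧ (e ∈ Dem → 0 < n e)
  let Dem' : Finset (Subtype P) := Finset.univ.filter fun e => (e : ε) ∈ Dem
  obtain ⟨F, p', q', hd⟩ := exists_isDual_of_drawing (fun e : Subtype P => p e)
    (fun e : Subtype P => q e) (fun e => e.2.1) pos (fun e => arc e) hpos (fun e => hcont e)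
    (fun e => h0 e) (fun e => h1 e) (fun e f hef => hdisj e f fun h => hef (Subtype.ext h))
    (fun e => hvert e)
  obtain ⟨I, S, hev, hdem, hSd, hcard⟩ := hd.exists_evenSets Dem' (fun e => n e) N hN0 (by
      intro e he
      have heD : (e : ε) ∈ Dem := (Finset.mem_filter.mp he).2
      refine ⟨e.2.2 heD, ?_⟩
      have h2 := (hnx e heD).trans (mul_le_mul_of_nonneg_left (hx01 e heD).2 (Nat.cast_nonneg N))
      rw [mul_one] at h2
      exact_mod_cast h2) (by
      intro U
      have hcut := hxcut {v | U v = 1}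
      have hmem := mem_cutF_iff hends U
      rw [← Int.cast_nonneg_iff (R := ℝ), Int.cast_sum]
      have h2 : ∑ e, (if U (p e) + U (q e) = 1 then (if e ∈ Dem then -(N * x e) else N) else 0) =
          N * (((cutF ends {v | U v = 1} \ Dem).card : ℝ) -
            ∑ e ∈ cutF ends {v | U v = 1} ∩ Dem, x e) := by
        rw [Finset.card_eq_sum_ones, Nat.cast_sum, mul_sub, Finset.mul_sum, Finset.mul_sum,
          ← Finset.sum_filter, show (Finset.univ.filter fun e => U (p e) + U (q e) = 1) =
            cutF ends {v | U v = 1} by ext e; simp [hmem], Finset.sum_ite, Finset.sum_neg_distrib,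
          Finset.filter_mem_eq_inter, Finset.filter_notMem_eq_sdiff]
        simp only [Nat.cast_one, mul_one]
        ring
      refine (mul_nonneg (Nat.cast_nonneg N) (sub_nonneg.mpr hcut)).trans (h2.symm.le.trans ?_)
      have h3 := Finset.sum_subtype (F := Subtype.fintype P) (Finset.univ.filter P) (by simp)
        fun e =>
        if U (p e) + U (q e) = 1 then (if e ∈ Dem then -(n e : ℝ) else N) else 0
      refine le_trans ?_ (h3.trans (Finset.sum_congr rfl fun e _ => ?_)).le
      · rw [Finset.sum_filter]
        refine Finset.sum_le_sum fun e _ => ?_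
        by_cases hcute : U (p e) + U (q e) = 1
        · have hpq : p e ≠ q e := fun h => by
            rw [h, ZMod.two_self_add] at hcute
            exact absurd hcute (by decide)
          rw [if_pos hcute, if_pos hcute]
          by_cases heD : e ∈ Dem
          · rw [if_pos heD, if_pos heD]
            have h4 := hnx e heD
            split_ifs
            · linarith
            · linarith [Nat.cast_nonneg (α := ℝ) (n e)]
          · rw [if_neg heD, if_neg heD, if_pos ⟨hpq, fun h => absurd h heD⟩]
        · simp [hcute]
      · have h4 : e ∈ Dem' ↔ (e : ε) ∈ Dem := by simp [Dem']
        simp only [h4]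
        push_cast
        split_ifs <;> simp)
  have hC : ∀ i ∈ I, ∃ C ⊆ S i, IsCycle (fun e : Subtype P => ends e) C ∧
      ∃ e ∈ Dem', ∀ f ∈ Dem', f ∈ C ↔ f = e := by
    intro i hi
    obtain ⟨e, heD, he⟩ := hdem i hi
    obtain ⟨C, hCS, heC, hC⟩ := (hev i hi).exists_isCycle (ends := fun e : Subtype P => ends e)
      (fun e => hends e) ((he e heD).mpr rfl)
    refine ⟨C, hCS, hC, e, heD, fun f hf => ⟨fun h => (he f hf).mp (hCS h), ?_⟩⟩
    rintro rfl
    exact heC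
  choose! C hCS hC hCD using hC
  have hDem' : ∀ e : Subtype P, e ∈ Dem' ↔ (e : ε) ∈ Dem := fun e => by simp [Dem']
  refine ⟨_, I, fun i => (C i).map (Function.Embedding.subtype P), ?_, ?_, ?_, ?_, ?_⟩
  · exact fun i hi => (hC i hi).map_subtype
  · intro i hi
    obtain ⟨e, heD, he⟩ := hCD i hi
    refine ⟨e, (hDem' e).mp heD, fun f hf => ⟨fun hfC => ?_, ?_⟩⟩
    · obtain ⟨g, hg, rfl⟩ := Finset.mem_map.mp hfC
      exact congrArg Subtype.val ((he g ((hDem' g).mpr hf)).mp hg)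
    · rintro rfl
      exact Finset.mem_map_of_mem _ ((he e heD).mpr rfl)
  · intro i hi e he
    obtain ⟨f, -, rfl⟩ := Finset.mem_map.mp he
    exact f.2.1
  · intro i hi j hj hij
    rw [Finset.disjoint_map]
    exact (hSd i hi j hj hij).mono (hCS i hi) (hCS j hj)
  · have h2 : ∑ e ∈ Dem', (n e : ℝ) = ∑ e ∈ Dem.filter (fun e => p e ≠ q e), (n e : ℝ) := by
      refine Finset.sum_bij_ne_zero (fun e _ _ => (e : ε)) ?_ ?_ ?_ ?_
      · exact fun e he _ => Finset.mem_filter.mpr ⟨(hDem' e).mp he, e.2.1⟩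
      · exact fun e _ _ f _ _ h => Subtype.ext h
      · intro e he hne
        rw [Finset.mem_filter] at he
        have h3 : 0 < n e := Nat.pos_of_ne_zero fun h => hne (by rw [h, Nat.cast_zero])
        exact ⟨⟨e, he.2, fun _ => h3⟩, (hDem' _).mpr he.1, hne, rfl⟩
      · exact fun _ _ _ => rfl
    have h3 : N * X ≤ ∑ e ∈ Dem', (n e : ℝ) + Dem.card := by
      rw [h2, hX, Finset.mul_sum]
      refine (Finset.sum_le_sum fun e _ => hxn e).trans ?_
      rw [Finset.sum_add_distrib]
      have h4 : ((Dem.filter fun e => p e ≠ q e).card : ℝ) ≤ Dem.card := by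
        exact_mod_cast Finset.card_filter_le _ _
      simpa using h4
    have h4 : ∑ e ∈ Dem', (n e : ℝ) ≤ 7 * N * I.card := by exact_mod_cast hcard
    have h5 : (N : ℝ) * X ≤ N * (14 * I.card) := by linarith
    exact le_of_mul_le_mul_left h5 (by exact_mod_cast hN0)

/-- if `G+H` is planar and connected, then for every feasible solution `x`
of the cut-version LP there is a family of pairwise edge-disjoint `D`-cycles of
cardinality at least `(1/32) ∑_{e ∈ D} x_e`. -/
theorem stmt16 {V ε : Type} [Fintype V] [DecidableEq V] [Fintype ε] [DecidableEq ε]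
    (ends : ε → Sym2 V) (Dem : Finset ε)
    (hplanar : IsPlanar ends) (hconn : MGConnected ends)
    (x : ε → ℝ)
    (hx01 : ∀ e ∈ Dem, 0 ≤ x e ∧ x e ≤ 1)
    (hxcut : ∀ U : Set V,
      ∑ e ∈ cutF ends U ∩ Dem, x e ≤ ((cutF ends U \ Dem).card : ℝ)) :
    ∃ (k : ℕ) (Cyc : Fin k → Finset ε),
      (∀ i, IsDCycle ends Dem (Cyc i)) ∧
      (∀ i j, i ≠ j → Disjoint (Cyc i) (Cyc j)) ∧
      ∑ e ∈ Dem, x e ≤ 32 * (k : ℝ) := by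
  obtain ⟨pos, arc, hpos, hcont, hends, -, hdisj, hvert⟩ := hplanar
  have hpq : ∀ e, ∃ a b, ends e = s(a, b) ∧ arc e 0 = pos a ∧ arc e 1 = pos b := by
    intro e
    obtain ⟨⟨a, b⟩, hab⟩ := Sym2.mk_surjective (ends e)
    rcases hends e a b hab.symm with h | h
    · exact ⟨a, b, hab.symm, h⟩
    · exact ⟨b, a, hab.symm.trans Sym2.eq_swap, h⟩
  choose p q hpq h0 h1 using hpq
  obtain ⟨ι, I, C, hC, hCD, hCl, hCd, hcard⟩ := exists_disjoint_cycles hpq pos arc hpos hcont h0 h1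
    hdisj hvert Dem x hx01 (fun U => by convert hxcut U)
  set L := Dem.filter fun e => ¬ p e ≠ q e with hL
  have hloop : ∀ e ∈ L, e ∈ Dem ∧ p e = q e := fun e he => by
    simpa using Finset.mem_filter.mp he
  let f : I ⊕ L → Finset ε := Sum.elim (fun i => C i) fun e => {(e : ε)}
  have hf : ∀ t, IsDCycle ends Dem (f t) := by
    rintro (⟨i, hi⟩ | ⟨e, he⟩)
    · obtain ⟨e, heD, he⟩ := hCD i hi
      refine ⟨hC i hi, Finset.card_eq_one.mpr ⟨e, ?_⟩⟩
      ext g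
      simp only [f, Sum.elim_inl, Finset.mem_inter, Finset.mem_singleton]
      constructor
      · exact fun h => (he g h.2).mp h.1
      · rintro rfl
        exact ⟨(he g heD).mpr rfl, heD⟩
    · have h2 := hloop e he
      refine ⟨IsCycle.singleton (v := p e) (by rw [hpq, ← h2.2]), ?_⟩
      simp [f, h2.1]
  have hfd : ∀ s t, s ≠ t → Disjoint (f s) (f t) := by
    have hCL : ∀ i : I, ∀ e : L, Disjoint (C i) {(e : ε)} := fun i e =>
      Finset.disjoint_singleton_right.mpr fun h => hCl i i.2 e h (hloop e e.2).2
    rintro (i | e) (j | e') hst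
    · exact hCd i i.2 j j.2 fun h => hst (congrArg Sum.inl (Subtype.ext h))
    · exact hCL i e'
    · exact (hCL j e).symm
    · exact Finset.disjoint_singleton.mpr fun h => hst (congrArg Sum.inr (Subtype.ext h))
  refine ⟨Fintype.card (I ⊕ L), fun i => f ((Fintype.equivFin _).symm i), fun i => hf _,
    fun i j hij => hfd _ _ fun h => hij ((Fintype.equivFin _).symm.injective h), ?_⟩
  have h2 : ∑ e ∈ L, x e ≤ L.card := by
    simpa using Finset.sum_le_card_nsmul L x 1 fun e he => (hx01 e (hloop e he).1).2
  have h3 : ((Fintype.card (I ⊕ L) : ℕ) : ℝ) = I.card + L.card := by simp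
  have hsplit : ∑ e ∈ Dem with p e ≠ q e, x e + ∑ e ∈ L, x e = ∑ e ∈ Dem, x e :=
    Finset.sum_filter_add_sum_filter_not Dem (fun e => p e ≠ q e) x
  have hcard' : ∑ e ∈ Dem with p e ≠ q e, x e ≤ 14 * (I.card : ℝ) := by convert hcard
  rw [h3, ← hsplit]
  have h4 : (0 : ℝ) ≤ I.card := Nat.cast_nonneg _
  have h5 : (0 : ℝ) ≤ L.card := Nat.cast_nonneg _
  linarith

end
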